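/- arXiv:1008.4808 — 3 statements merged into one kernel-verified Lean document; each statement's English description precedes it below -/
import Mathlib

section
/- Let p be an odd prime and let K be a finite extension of ℚ_p whose residue field has cardinality q. Then the trinomial f(x) = x^{(q−1)(1+q^{q−1})} − (1+q^{q−1})·x^{q−1} + q^{q−1} ∈ K[x] has at least 3(q−1) roots in K \ {0} counted with multiplicities: each of the q−1 distinct (q−1)-th roots of unity in K is a root of multiplicity at least 2, and there are q−1 further distinct simple roots of positive valuation. -/
open scoped Classical
open Polynomial

/-- Hensel's lemma for the unit ball of a complete ultrametric field. -/
theorem hensel_ball {K : Type*} [NormedField K] [IsUltrametricDist K] [CompleteSpace K]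
    {A : Type*} [CommRing A] [Algebra A K]
    (hinj : Function.Injective (algebraMap A K))
    (hA : ∀ x : K, (∃ a : A, algebraMap A K a = x) ↔ ‖x‖ ≤ 1)
    (M : Ideal A) (hM : M.IsMaximal) (g : A[X]) (hg : g.Monic) (a : A)
    (h0 : g.eval a ∈ M) (h1 : g.derivative.eval a ∉ M) :
    ∃ b : A, g.eval b = 0 ∧ b - a ∈ M := by
  have hle : ∀ x : A, ‖algebraMap A K x‖ ≤ 1 := fun x => (hA _).1 ⟨x, rfl⟩
  have hdvd : ∀ x y : A, y ≠ 0 → ‖algebraMap A K x‖ ≤ ‖algebraMap A K y‖ → y ∣ x := by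
    intro x y hy hxy
    have hy' : algebraMap A K y ≠ 0 := fun h => hy (hinj (by simpa using h))
    have : ‖algebraMap A K x / algebraMap A K y‖ ≤ 1 := by
      rw [norm_div]; exact div_le_one_of_le₀ hxy (norm_nonneg _)
    obtain ⟨c, hc⟩ := (hA _).2 this
    refine ⟨c, hinj ?_⟩
    rw [map_mul, hc]; field_simp
  have hunit : ∀ x : A, ‖algebraMap A K x‖ = 1 → IsUnit x := by
    intro x hx
    apply isUnit_of_dvd_one
    apply hdvd
    · rintro rfl; simp at hx
    · simp [hx]
  have hMlt : ∀ x ∈ M, ‖algebraMap A K x‖ < 1 := by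
    intro x hx
    refine lt_of_le_of_ne (hle x) fun h => hM.ne_top (M.eq_top_of_isUnit_mem hx (hunit x h))
  have hltM : ∀ x, ‖algebraMap A K x‖ < 1 → x ∈ M := by
    intro x hx
    by_contra hxM
    obtain ⟨y, hy⟩ := hM.exists_inv hxM
    obtain ⟨m, hm, hym⟩ := hy
    have h2 : (algebraMap A K y) * algebraMap A K x + algebraMap A K m = 1 := by
      rw [← map_mul, ← map_add, hym, map_one]
    have h3 : ‖(algebraMap A K y) * algebraMap A K x + algebraMap A K m‖ < 1 := by
      refine lt_of_le_of_lt (IsUltrametricDist.norm_add_le_max _ _) (max_lt ?_ (hMlt m hm))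
      rw [norm_mul]
      exact lt_of_le_of_lt (mul_le_of_le_one_left (norm_nonneg _) (hle y)) hx
    rw [h2, norm_one] at h3
    exact lt_irrefl _ h3
  by_cases ht : g.eval a = 0
  · exact ⟨a, ht, by simp⟩
  set t := g.eval a with htdef
  have htlt := hMlt t h0
  have htK : algebraMap A K t ≠ 0 := fun h => ht (hinj (by simpa using h))
  have hmem : ∀ (n : ℕ) (x y : A), x ≡ y [SMOD ((Ideal.span {t}) ^ n • ⊤ : Ideal A)] ↔
      ‖algebraMap A K x - algebraMap A K y‖ ≤ ‖algebraMap A K t‖ ^ n := by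
    intro n x y
    rw [← Ideal.one_eq_top, Ideal.smul_eq_mul, mul_one, SModEq.sub_mem, Ideal.span_singleton_pow,
      Ideal.mem_span_singleton, ← map_sub, ← norm_pow, ← map_pow]
    constructor
    · rintro ⟨c, hc⟩
      rw [hc, map_mul, norm_mul]
      exact mul_le_of_le_one_right (norm_nonneg _) (hle c)
    · intro h
      refine hdvd _ _ ?_ h
      intro h'
      apply htK
      have := congrArg (algebraMap A K) h'
      rw [map_pow, map_zero] at this
      exact eq_zero_of_pow_eq_zero this
  have htend := tendsto_pow_atTop_nhds_zero_of_lt_one (norm_nonneg (algebraMap A K t)) htlt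
  have : IsAdicComplete (Ideal.span {t}) A :=
    { haus' := by
        intro x hx
        apply hinj
        rw [map_zero, ← norm_le_zero_iff]
        refine ge_of_tendsto' htend fun n => ?_
        have := (hmem n x 0).1 (hx n)
        simpa using this
      prec' := by
        intro f hf
        have hf' : ∀ {m n}, m ≤ n →
            ‖algebraMap A K (f m) - algebraMap A K (f n)‖ ≤ ‖algebraMap A K t‖ ^ m :=
          fun h => (hmem _ _ _).1 (hf h)
        have hc : CauchySeq (fun n => algebraMap A K (f n)) := by
          refine cauchySeq_of_le_geometric (‖algebraMap A K t‖) 1 htlt fun n => ?_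
          rw [dist_eq_norm, one_mul]
          exact hf' (Nat.le_succ n)
        obtain ⟨L, hL⟩ := cauchySeq_tendsto_of_complete hc
        have hL1 : ‖L‖ ≤ 1 := le_of_tendsto' hL.norm fun n => hle _
        obtain ⟨l, rfl⟩ := (hA _).2 hL1
        refine ⟨l, fun n => (hmem _ _ _).2 ?_⟩
        refine le_of_tendsto (tendsto_const_nhds.sub hL).norm ?_
        filter_upwards [Filter.eventually_ge_atTop n] with m hm
        exact hf' hm }
  have hH := IsAdicComplete.henselianRing A (Ideal.span {t})
  obtain ⟨b, hb, hba⟩ := hH.is_henselian g hg a (Ideal.mem_span_singleton_self _) (by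
    apply IsUnit.map
    apply hunit
    refine le_antisymm (hle _) (not_lt.1 fun h => h1 (hltM _ h)))
  exact ⟨b, hb, (Ideal.span_singleton_le_iff_mem M).2 h0 hba⟩

theorem spectral_le_one_iff (p : ℕ) [Fact p.Prime]
    (K : Type*) [Field K] [Algebra ℚ_[p] K] [FiniteDimensional ℚ_[p] K]
    [Algebra ℤ_[p] K] [IsScalarTower ℤ_[p] ℚ_[p] K] (x : K) :
    IsIntegral ℤ_[p] x ↔ spectralNorm ℚ_[p] K x ≤ 1 := by
  have hxi : IsIntegral ℚ_[p] x := Algebra.IsIntegral.isIntegral x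
  rw [spectralNorm, spectralValue_le_one_iff (minpoly.monic hxi)]
  constructor
  · intro h n
    rw [minpoly.isIntegrallyClosed_eq_field_fractions' ℚ_[p] h, coeff_map]
    exact PadicInt.norm_le_one _
  · intro h
    obtain ⟨g, hg, -, hm⟩ := lifts_and_natDegree_eq_and_monic
      (p := minpoly ℚ_[p] x) (f := algebraMap ℤ_[p] ℚ_[p])
      ((lifts_iff_coeff_lifts _).2 fun n => ⟨⟨_, h n⟩, rfl⟩) (minpoly.monic hxi)
    refine ⟨g, hm, ?_⟩
    rw [← aeval_def, ← aeval_map_algebraMap ℚ_[p], hg, minpoly.aeval]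

theorem hensel_integralClosure (p : ℕ) [Fact p.Prime]
    (K : Type*) [Field K] [Algebra ℚ_[p] K] [FiniteDimensional ℚ_[p] K]
    [Algebra ℤ_[p] K] [IsScalarTower ℤ_[p] ℚ_[p] K]
    (M : Ideal (integralClosure ℤ_[p] K)) (hM : M.IsMaximal)
    (g : (integralClosure ℤ_[p] K)[X]) (hg : g.Monic) (a : integralClosure ℤ_[p] K)
    (h0 : g.eval a ∈ M) (h1 : g.derivative.eval a ∉ M) :
    ∃ b, g.eval b = 0 ∧ b - a ∈ M := by
  let := spectralNorm.normedField ℚ_[p] K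
  have : CompleteSpace K := spectralNorm.completeSpace ℚ_[p] K
  have : IsUltrametricDist K :=
    IsUltrametricDist.isUltrametricDist_of_isNonarchimedean_norm
      (isNonarchimedean_spectralNorm (K := ℚ_[p]) (L := K))
  refine hensel_ball (K := K) Subtype.val_injective ?_ M hM g hg a h0 h1
  intro x
  refine Iff.trans ?_ (spectral_le_one_iff p K x)
  constructor
  · rintro ⟨a, rfl⟩; exact a.2
  · intro h; exact ⟨⟨x, h⟩, rfl⟩

theorem trinomial_core {K : Type*} [Field K] [CharZero K] {A : Type*} [CommRing A] [Algebra A K]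
    (hinj : Function.Injective (algebraMap A K))
    (M : Ideal A) (hM : M.IsMaximal)
    (hens : ∀ (g : A[X]), g.Monic → ∀ a : A, g.eval a ∈ M → g.derivative.eval a ∉ M →
      ∃ b : A, g.eval b = 0 ∧ b - a ∈ M)
    (q : ℕ) (hq : Nat.card (A ⧸ M) = q) (d Q : ℕ) (hd : d = q - 1) (hQ : Q = q ^ d) :
    3 * d ≤
      (((X : Polynomial K) ^ (d * (1 + Q))
          - C (((1 + Q : ℕ) : K)) * (X : Polynomial K) ^ d
          + C ((Q : ℕ) : K)).roots.filter (fun r => r ≠ 0)).card := by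
  by_cases hd0 : d = 0
  · simp [hd0]
  have hq2 : 2 ≤ q := by omega
  have hQpos : 0 < Q := by rw [hQ]; positivity
  let _ : Field (A ⧸ M) := Ideal.Quotient.field M
  have hfin : Finite (A ⧸ M) := Nat.finite_of_card_ne_zero (by omega)
  let _ : Fintype (A ⧸ M) := Fintype.ofFinite _
  have hcard : Fintype.card (A ⧸ M) = q := by rw [← hq, Nat.card_eq_fintype_card]
  have hq0 : ((q : ℕ) : A ⧸ M) = 0 := by rw [← hcard]; exact Nat.cast_card_eq_zero _
  have hQ0 : ((Q : ℕ) : A ⧸ M) = 0 := by rw [hQ, Nat.cast_pow, hq0, zero_pow hd0]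
  have hdm : ((d : ℕ) : A ⧸ M) = -1 := by
    rw [hd, Nat.cast_sub (by omega), hq0]; simp
  have hqM : ((q : ℕ) : A) ∈ M := by
    rw [← Ideal.Quotient.eq_zero_iff_mem, map_natCast, hq0]
  have hpow : ∀ c : (A ⧸ M)ˣ, (c : A ⧸ M) ^ d = 1 := fun c => by
    rw [hd, ← hcard]; exact FiniteField.pow_card_sub_one_eq_one _ c.ne_zero
  -- the roots of unity
  have hz : ∀ c : (A ⧸ M)ˣ, ∃ b : A, b ^ d = 1 ∧ Ideal.Quotient.mk M b = c := by
    intro c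
    obtain ⟨a, ha⟩ := Ideal.Quotient.mk_surjective (c : A ⧸ M)
    obtain ⟨b, hb, hba⟩ := hens (X ^ d - 1) (monic_X_pow_sub_C 1 hd0) a (by
      rw [← Ideal.Quotient.eq_zero_iff_mem]
      simp [ha, hpow]) (by
      rw [← Ideal.Quotient.eq_zero_iff_mem]
      simp [ha, hdm, derivative_X_pow])
    refine ⟨b, ?_, ?_⟩
    · simpa [sub_eq_zero] using hb
    · rw [← ha]; exact Ideal.Quotient.eq.2 hba
  have hw : ∀ c : (A ⧸ M)ˣ, ∃ b : A,
      b ^ (d * (1 + Q)) - ((1 + Q : ℕ) : A) * b ^ (d * Q) + ((Q ^ Q : ℕ) : A) = 0 ∧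
        Ideal.Quotient.mk M b = c := by
    intro c
    obtain ⟨a, ha⟩ := Ideal.Quotient.mk_surjective (c : A ⧸ M)
    obtain ⟨b, hb, hba⟩ := hens (X ^ (d * (1 + Q)) +
        (- (C ((1 + Q : ℕ) : A) * X ^ (d * Q)) + C ((Q ^ Q : ℕ) : A))) (by
      apply monic_X_pow_add
      have hlt : d * Q < d * (1 + Q) := by
        have := Nat.pos_of_ne_zero hd0
        nlinarith
      refine lt_of_le_of_lt (degree_add_le _ _) (max_lt ?_ ?_)
      · rw [degree_neg]
        exact lt_of_le_of_lt (degree_C_mul_X_pow_le _ _) (by exact_mod_cast hlt)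
      · refine lt_of_le_of_lt degree_C_le ?_
        have : 0 < d * (1 + Q) := by omega
        exact_mod_cast this) a (by
      rw [← Ideal.Quotient.eq_zero_iff_mem]
      simp [ha, hpow, pow_mul, hQ0, hQpos.ne']) (by
      rw [← Ideal.Quotient.eq_zero_iff_mem]
      rw [derivative_add, derivative_add, derivative_C]
      simp [ha, hdm, hQ0, derivative_X_pow])
    refine ⟨b, ?_, ?_⟩
    · rw [← hb]; simp; ring
    · rw [← ha]; exact Ideal.Quotient.eq.2 hba
  choose z hz1 hz2 using hz
  choose w hw1 hw2 using hw
  have hqK : (q : K) ≠ 0 := Nat.cast_ne_zero.2 (by omega)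
  have hzK : ∀ c, (algebraMap A K (z c)) ^ d = 1 := fun c => by
    rw [← map_pow, hz1, map_one]
  have hwne : ∀ c, algebraMap A K (w c) ≠ 0 := by
    intro c h
    have h' : w c = 0 := hinj (by simpa using h)
    have := hw2 c
    rw [h', map_zero] at this
    exact c.ne_zero this.symm
  have hwK : ∀ c, (algebraMap A K (w c)) ^ (d * (1 + Q))
      - (1 + (Q : K)) * (algebraMap A K (w c)) ^ (d * Q) + (Q : K) ^ Q = 0 := fun c => by
    have := congrArg (algebraMap A K) (hw1 c)
    simpa using this
  set f : K[X] := (X : Polynomial K) ^ (d * (1 + Q))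
          - C (((1 + Q : ℕ) : K)) * (X : Polynomial K) ^ d
          + C ((Q : ℕ) : K) with hf
  have hf0 : f.eval 0 ≠ 0 := by
    simp [hf, hd0, hQpos.ne']
  have hfne : f ≠ 0 := by
    intro h; rw [h] at hf0; simp at hf0
  let S : Finset K := Finset.univ.image fun c : (A ⧸ M)ˣ => algebraMap A K (z c)
  let T : Finset K := Finset.univ.image fun c : (A ⧸ M)ˣ => (q : K) / algebraMap A K (w c)
  have hU : Fintype.card (A ⧸ M)ˣ = d := by
    rw [Fintype.card_units, hcard, hd]
  have hS : S.card = d := by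
    rw [Finset.card_image_of_injective, Finset.card_univ, hU]
    intro c c' h
    have := hinj h
    ext; rw [← hz2, this, hz2]
  have hT : T.card = d := by
    rw [Finset.card_image_of_injective, Finset.card_univ, hU]
    intro c c' h
    have h' : algebraMap A K (w c) = algebraMap A K (w c') := by
      have h1 := hwne c
      have h2 := hwne c'
      simp only at h
      field_simp at h
      exact h.symm
    have := hinj h'
    ext; rw [← hw2, this, hw2]
  have hST : Disjoint S T := by
    rw [Finset.disjoint_left]
    intro r hr hr'
    obtain ⟨c, -, rfl⟩ := Finset.mem_image.1 hr
    obtain ⟨c', -, h⟩ := Finset.mem_image.1 hr'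
    rw [div_eq_iff (hwne c'), ← map_mul, ← map_natCast (algebraMap A K)] at h
    have h2 := congrArg (Ideal.Quotient.mk M) (hinj h)
    rw [map_natCast, hq0, map_mul, hz2, hw2] at h2
    exact (c * c').ne_zero (by simpa using h2.symm)
  have hSroot : ∀ r ∈ S, 2 ≤ f.roots.count r := by
    intro r hr
    obtain ⟨c, -, rfl⟩ := Finset.mem_image.1 hr
    have h1 := hzK c
    set ζ := algebraMap A K (z c)
    have hζ : ζ ≠ 0 := by
      intro h; rw [h, zero_pow hd0] at h1; exact zero_ne_one h1
    rw [count_roots]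
    refine (one_lt_rootMultiplicity_iff_isRoot hfne).2 ⟨?_, ?_⟩
    · simp [hf, pow_mul, h1]
    · have h3 : ζ ^ (d * (1 + Q) - 1) = ζ ^ (d - 1) := by
        have e : d * (1 + Q) - 1 = d * Q + (d - 1) := by
          have := Nat.pos_of_ne_zero hd0
          rw [Nat.mul_add]; omega
        rw [e, pow_add, pow_mul, h1, one_pow, one_mul]
      simp [hf, derivative_X_pow, h3]
      ring
  have hTroot : ∀ r ∈ T, 1 ≤ f.roots.count r := by
    intro r hr
    obtain ⟨c, -, rfl⟩ := Finset.mem_image.1 hr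
    rw [Multiset.one_le_count_iff_mem, mem_roots hfne]
    have h1 := hwK c
    have h2 := hwne c
    set v := algebraMap A K (w c)
    have hQK : (q : K) ^ d = Q := by rw [hQ, Nat.cast_pow]
    have e : eval ((q : K) / v) f * v ^ (d * (1 + Q)) = Q * (v ^ (d * (1 + Q))
      - (1 + (Q : K)) * v ^ (d * Q) + (Q : K) ^ Q) := by
      have e1 : v ^ (d * (1 + Q)) = v ^ (d * Q) * v ^ d := by ring
      simp only [hf, eval_add, eval_sub, eval_pow, eval_X, eval_mul, eval_C, div_pow]
      rw [pow_mul (q : K), hQK, e1]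
      have h3 : v ^ d ≠ 0 := pow_ne_zero _ h2
      have h4 : v ^ (d * Q) ≠ 0 := pow_ne_zero _ h2
      push_cast
      field_simp
      ring
    rw [h1, mul_zero] at e
    exact (mul_eq_zero.1 e).resolve_right (pow_ne_zero _ h2)
  have hle : 2 • S.val + T.val ≤ f.roots.filter (fun r => r ≠ 0) := by
    rw [Multiset.le_iff_count]
    intro r
    rw [Multiset.count_add, Multiset.count_nsmul]
    by_cases hrS : r ∈ S
    · have hrT : r ∉ T := Finset.disjoint_left.1 hST hrS
      have := hSroot r hrS
      have hr0 : r ≠ 0 := by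
        rintro rfl
        have hm := Multiset.count_pos.1 (lt_of_lt_of_le two_pos this)
        exact hf0 (isRoot_of_mem_roots hm)
      rw [Multiset.count_eq_zero.2 hrT, Multiset.count_eq_one_of_mem S.nodup hrS,
        Multiset.count_filter_of_pos (p := fun r : K => r ≠ 0) hr0]
      omega
    · rw [Multiset.count_eq_zero.2 hrS]
      by_cases hrT : r ∈ T
      · have := hTroot r hrT
        have hr0 : r ≠ 0 := by
          rintro rfl
          have hm := Multiset.count_pos.1 (lt_of_lt_of_le one_pos this)
          exact hf0 (isRoot_of_mem_roots hm)
        rw [Multiset.count_eq_one_of_mem T.nodup hrT, Multiset.count_filter_of_pos (p := fun r : K => r ≠ 0) hr0]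
        omega
      · rw [Multiset.count_eq_zero.2 hrT]; simp
  have := Multiset.card_le_card hle
  rw [Multiset.card_add, Multiset.card_nsmul, Finset.card_val, Finset.card_val, hS, hT] at this
  omega

/-- Let `p` be an odd prime and `K/ℚ_p` a finite extension
whose residue field (the quotient of the ring of integers, i.e. the integral
closure of `ℤ_p` in `K`, by its maximal ideal `M`) has cardinality `q`.  Then
the trinomial `x^((q−1)(1+q^(q−1))) − (1+q^(q−1))·x^(q−1) + q^(q−1)` has at
least `3(q−1)` roots in `K \ {0}` counted with multiplicities. -/
theorem trinomial_many_roots (p : ℕ) [Fact p.Prime] (hodd : p ≠ 2)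
    (K : Type*) [Field K] [Algebra ℚ_[p] K] [FiniteDimensional ℚ_[p] K]
    [Algebra ℤ_[p] K] [IsScalarTower ℤ_[p] ℚ_[p] K]
    (M : Ideal (integralClosure ℤ_[p] K)) (hM : M.IsMaximal)
    (q : ℕ) (hq : Nat.card ((integralClosure ℤ_[p] K) ⧸ M) = q) :
    3 * (q - 1) ≤
      (((X : Polynomial K) ^ ((q - 1) * (1 + q ^ (q - 1)))
          - C (((1 + q ^ (q - 1) : ℕ) : K)) * (X : Polynomial K) ^ (q - 1)
          + C (((q ^ (q - 1) : ℕ) : K))).roots.filter (fun r => r ≠ 0)).card := by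
  have : CharZero K := charZero_of_injective_algebraMap (algebraMap ℚ_[p] K).injective
  exact trinomial_core (K := K) (A := integralClosure ℤ_[p] K) Subtype.val_injective M hM
    (hensel_integralClosure p K M hM) q hq (q - 1) (q ^ (q - 1)) rfl rfl
end

section
/- Let p be an odd prime, let K be a finite extension of ℚ_p whose residue field has cardinality q, and let t ≥ 1. Then there exists a nonzero polynomial in K[x] with at most t+1 nonzero terms having at least (2t−1)(q−1) distinct roots in K \ {0}; that is, B₁(t,K) ≥ (2t−1)(q−1). -/
section

open Polynomial Filter Topology

variable {p : ℕ} [Fact p.Prime]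

theorem dvd_of_norm_le {x y : ℤ_[p]} (hy : y ≠ 0) (h : ‖x‖ ≤ ‖y‖) : y ∣ x := by
  have hy' : (y : ℚ_[p]) ≠ 0 := by simpa using hy
  refine ⟨⟨(x : ℚ_[p]) / y, ?_⟩, ?_⟩
  · rw [norm_div, PadicInt.padic_norm_e_of_padicInt, PadicInt.padic_norm_e_of_padicInt]
    exact div_le_one_of_le₀ h (norm_nonneg _)
  · apply Subtype.ext
    change (x : ℚ_[p]) = y * (x / y)
    field_simp

theorem norm_sub_le_max' (x y : ℤ_[p]) : ‖x - y‖ ≤ max ‖x‖ ‖y‖ := by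
  rw [sub_eq_add_neg, ← norm_neg y]
  exact PadicInt.nonarchimedean _ _

theorem norm_nat_ge (hodd : p ≠ 2) (k : ℕ) (hk : 2 ≤ k) (x : ℤ_[p]) (hx : ‖x‖ < 1) :
    ‖x‖ ^ (k - 2) ≤ ‖(k : ℤ_[p])‖ := by
  have hp : p.Prime := Fact.out
  have h3 : 3 ≤ p := by have := hp.two_le; omega
  by_contra! hlt
  obtain ⟨y, rfl⟩ := (PadicInt.norm_lt_one_iff_dvd x).1 hx
  have h1 : ‖(k : ℤ_[p])‖ < (p : ℝ) ^ (-((k - 2 : ℕ) : ℤ)) := by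
    refine hlt.trans_le ?_
    rw [norm_mul, PadicInt.norm_p, mul_pow, zpow_neg, zpow_natCast, inv_pow]
    exact mul_le_of_le_one_right (by positivity) (pow_le_one₀ (norm_nonneg _) (PadicInt.norm_le_one _))
  have h2 : ‖((k:ℤ) : ℤ_[p])‖ ≤ (p : ℝ) ^ (-((k - 1 : ℕ) : ℤ)) := by
    have := (PadicInt.norm_le_pow_iff_norm_lt_pow_add_one (k : ℤ_[p]) (-((k - 1 : ℕ) : ℤ))).2
      (by convert h1 using 2; omega)
    simpa using this
  rw [PadicInt.norm_int_le_pow_iff_dvd] at h2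
  have h4 : p ^ (k-1) ∣ k := by exact_mod_cast h2
  have h5 := Nat.le_of_dvd (by omega) h4
  have h6 : 3 ^ (k-1) ≤ p ^ (k-1) := Nat.pow_le_pow_left h3 _
  have h7 : ∀ n : ℕ, 1 ≤ n → n + 1 < 3 ^ n := by
    intro n hn
    induction n, hn using Nat.le_induction with
    | base => norm_num
    | succ n hn ih => rw [pow_succ]; omega
  have := h7 (k-1) (by omega)
  omega

theorem lemC (hodd : p ≠ 2) (x : ℤ_[p]) (hx : ‖x‖ < 1) (n : ℕ) :
    ‖(1 + x) ^ n - 1 - n * x‖ ≤ ‖(n : ℤ_[p])‖ * ‖x‖ ^ 2 := by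
  rcases Nat.lt_or_ge n 2 with hn | hn
  · interval_cases n <;> simp
  have : (1 + x) ^ n - 1 - n * x =
      ∑ k ∈ Finset.Ico 2 (n + 1), x ^ k * (n.choose k : ℤ_[p]) := by
    rw [add_comm, add_pow, Finset.range_eq_Ico, Finset.sum_eq_sum_Ico_succ_bot (by omega),
      Finset.sum_eq_sum_Ico_succ_bot (by omega)]
    simp
    ring
  rw [this]
  refine IsUltrametricDist.norm_sum_le_of_forall_le_of_nonneg (by positivity) ?_
  intro k hk
  rw [Finset.mem_Ico] at hk
  obtain ⟨j, rfl⟩ : ∃ j, k = j + 2 := ⟨k - 2, by omega⟩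
  have h1 := norm_nat_ge hodd (j+2) (by omega) x hx
  have h2 : ((j + 2 : ℕ) : ℤ_[p]) * (n.choose (j+2) : ℤ_[p]) = n * ((n-1).choose (j+1) : ℕ) := by
    obtain ⟨n', rfl⟩ : ∃ n', n = n' + 1 := ⟨n - 1, by omega⟩
    have := Nat.add_one_mul_choose_eq n' (j+1)
    rw [show j + 2 = j + 1 + 1 from rfl, mul_comm]
    exact_mod_cast this.symm
  have h3 : ‖((j + 2 : ℕ) : ℤ_[p])‖ * ‖(n.choose (j+2) : ℤ_[p])‖ ≤ ‖(n : ℤ_[p])‖ := by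
    rw [← norm_mul, h2, norm_mul]
    exact mul_le_of_le_one_right (norm_nonneg _) (PadicInt.norm_le_one _)
  simp only [Nat.add_sub_cancel] at h1
  rw [norm_mul, norm_pow, pow_add, mul_right_comm]
  gcongr
  exact (mul_le_mul_of_nonneg_right h1 (norm_nonneg _)).trans h3

theorem norm_pow_sub_one (hodd : p ≠ 2) (x : ℤ_[p]) (hx : ‖x‖ < 1) (n : ℕ) :
    ‖(1 + x) ^ n - 1‖ = ‖(n : ℤ_[p])‖ * ‖x‖ := by
  have h := lemC hodd x hx n
  by_cases h0 : n = 0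
  · simp [h0]
  by_cases hx0 : x = 0
  · simp [hx0]
  rw [← norm_mul]
  have hx1 : 0 < ‖x‖ := norm_pos_iff.2 hx0
  have hn1 : 0 < ‖(n : ℤ_[p])‖ := norm_pos_iff.2 (by exact_mod_cast h0)
  have h' : ‖(1 + x) ^ n - 1 - n * x‖ < ‖(n : ℤ_[p]) * x‖ := by
    refine h.trans_lt ?_
    rw [norm_mul, sq, ← mul_assoc]
    exact mul_lt_of_lt_one_right (by positivity) hx
  have := IsUltrametricDist.norm_add_eq_max_of_norm_ne_norm h'.ne
  rw [sub_add_cancel, max_eq_right h'.le] at this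
  exact this

theorem exists_pow (hodd : p ≠ 2) (x : ℤ_[p]) (hx : ‖x‖ < 1) (hx0 : x ≠ 0)
    (u : ℤ_[p]) (hu : ‖u - 1‖ ≤ ‖x‖) (k : ℕ) :
    ∃ M : ℕ, 0 < M ∧ ‖(1 + x) ^ M - u‖ ≤ ‖x‖ * ((p : ℝ)⁻¹) ^ k := by
  induction k with
  | zero =>
    refine ⟨1, one_pos, ?_⟩
    have : (1 + x) ^ 1 - u = x - (u - 1) := by ring
    rw [this]
    simpa using (norm_sub_le_max' x (u-1)).trans (max_le le_rfl hu)
  | succ k ih =>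
    obtain ⟨M, hM, h⟩ := ih
    have hp0 : (p : ℤ_[p]) ≠ 0 := by exact_mod_cast (Fact.out : p.Prime).ne_zero
    have hxp : x * p ^ k ≠ 0 := mul_ne_zero hx0 (pow_ne_zero _ hp0)
    have hd : x * p ^ k ∣ (1 + x) ^ M - u := by
      apply dvd_of_norm_le hxp
      simpa [norm_mul] using h
    obtain ⟨s, hs⟩ := hd
    obtain ⟨i, hi⟩ : ∃ i : ℕ, ‖(i : ℤ_[p]) + s‖ < 1 := by
      obtain ⟨i, hi, hi'⟩ := PadicInt.exists_mem_range (-s)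
      refine ⟨i, ?_⟩
      rw [IsLocalRing.mem_maximalIdeal, PadicInt.mem_nonunits] at hi'
      rw [← norm_neg, show -((i : ℤ_[p]) + s) = -s - i by ring]
      exact hi'
    refine ⟨M + p ^ k * i, by omega, ?_⟩
    have hC := lemC hodd x hx (p ^ k * i)
    set R := (1 + x) ^ (p ^ k * i) - 1 - ((p ^ k * i : ℕ) : ℤ_[p]) * x with hR
    have e : (1 + x) ^ (M + p ^ k * i) - u = x * p ^ k * (i + s) +
        ((1 + x) ^ M - 1) * (x * p ^ k) * i + (1 + x)^M * R := by
      have : (1 + x) ^ (p ^ k * i) = 1 + ((p ^ k * i : ℕ) : ℤ_[p]) * x + R := by rw [hR]; ring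
      rw [pow_add, this]
      push_cast
      linear_combination hs
    have hn : ∀ y : ℤ_[p], ‖y‖ < 1 → ‖y‖ ≤ (p : ℝ)⁻¹ := by
      intro y hy
      obtain ⟨z, rfl⟩ := (PadicInt.norm_lt_one_iff_dvd y).1 hy
      rw [norm_mul, PadicInt.norm_p]
      exact mul_le_of_le_one_right (by positivity) (PadicInt.norm_le_one _)
    rw [e]
    have hpp : (0:ℝ) ≤ (p : ℝ)⁻¹ := by positivity
    refine (PadicInt.nonarchimedean _ _).trans (max_le ((PadicInt.nonarchimedean _ _).trans (max_le ?_ ?_)) ?_)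
    · rw [norm_mul, norm_mul, norm_pow, PadicInt.norm_p, pow_succ, ← mul_assoc]
      gcongr
      exact hn _ hi
    · rw [norm_mul, norm_mul, norm_mul, norm_pow, PadicInt.norm_p, pow_succ, norm_pow_sub_one hodd x hx]
      calc _ ≤ 1 * (p:ℝ)⁻¹ * (‖x‖ * (p:ℝ)⁻¹ ^ k) * 1 := by
            gcongr
            · exact PadicInt.norm_le_one _
            · exact hn _ hx
            · exact PadicInt.norm_le_one _
        _ = _ := by ring
    · rw [norm_mul]
      calc _ ≤ 1 * (‖((p ^ k * i : ℕ) : ℤ_[p])‖ * ‖x‖ ^ 2) := by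
            gcongr
            exact PadicInt.norm_le_one _
        _ ≤ 1 * ((p:ℝ)⁻¹ ^ k * (‖x‖ * (p : ℝ)⁻¹)) := by
            rw [sq]
            gcongr
            · push_cast
              rw [norm_mul, norm_pow, PadicInt.norm_p]
              exact mul_le_of_le_one_right (by positivity) (PadicInt.norm_le_one _)
            · exact hn _ hx
        _ = _ := by ring

/-- existence of the logarithm of `1 + x` -/
theorem exists_log (hodd : p ≠ 2) (x : ℤ_[p]) (hx : ‖x‖ < 1) (hx0 : x ≠ 0) :
    ∃ l : ℚ_[p], l ≠ 0 ∧ ∀ n : ℕ, ‖(((1 + x) ^ n - 1 : ℤ_[p]) : ℚ_[p]) - n * l‖ ≤ ‖(n : ℚ_[p])‖ ^ 2 := by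
  have hp : p.Prime := Fact.out
  have hp0 : (p : ℚ_[p]) ≠ 0 := by exact_mod_cast hp.ne_zero
  let D : ℕ → ℚ_[p] := fun n => (((1 + x) ^ n - 1 : ℤ_[p]) : ℚ_[p]) / n
  have hnorm : ∀ n : ℕ, ‖(n : ℤ_[p])‖ = ‖(n : ℚ_[p])‖ := fun n => by
    rw [← PadicInt.coe_natCast, PadicInt.padic_norm_e_of_padicInt]
  have h1 : ∀ m n : ℕ, m ≠ 0 → n ≠ 0 → ‖D (m * n) - D m‖ ≤ ‖(m : ℚ_[p])‖ := by
    intro m n hm hn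
    have hm' : (m : ℚ_[p]) ≠ 0 := by exact_mod_cast hm
    have hn' : (n : ℚ_[p]) ≠ 0 := by exact_mod_cast hn
    have hy := norm_pow_sub_one hodd x hx m
    set y := (1 + x) ^ m - 1 with hyd
    have hy1 : ‖y‖ < 1 := by
      rw [hy]; exact mul_lt_one_of_nonneg_of_lt_one_right (PadicInt.norm_le_one _) (norm_nonneg _) hx
    have hc := lemC hodd y hy1 n
    have e : D (m * n) - D m = (((1 + y) ^ n - 1 - n * y : ℤ_[p]) : ℚ_[p]) / (m * n) := by
      simp only [D]
      have : (1 + x) ^ (m * n) = (1 + y) ^ n := by rw [hyd, pow_mul]; ring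
      rw [this, ← hyd]
      push_cast
      field_simp
    rw [e, norm_div, PadicInt.padic_norm_e_of_padicInt, norm_mul]
    rw [div_le_iff₀ (by positivity)]
    refine hc.trans ?_
    rw [hy, hnorm, hnorm]
    have : ‖x‖ ^ 2 ≤ 1 := pow_le_one₀ (norm_nonneg _) hx.le
    calc ‖(n : ℚ_[p])‖ * (‖(m : ℚ_[p])‖ * ‖x‖) ^ 2 = ‖(n : ℚ_[p])‖ * ‖(m : ℚ_[p])‖ ^ 2 * ‖x‖ ^ 2 := by ring
      _ ≤ ‖(n : ℚ_[p])‖ * ‖(m : ℚ_[p])‖ ^ 2 * 1 := by gcongr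
      _ = _ := by ring
  have hcau : CauchySeq (fun k => D (p ^ k)) := by
    have hpi : (p : ℝ)⁻¹ < 1 := by
      have : (1 : ℝ) < p := by exact_mod_cast hp.one_lt
      exact inv_lt_one_of_one_lt₀ this
    refine cauchySeq_of_le_geometric ((p : ℝ)⁻¹) 1 hpi ?_
    intro k
    rw [dist_comm, dist_eq_norm, pow_succ]
    refine (h1 (p ^ k) p (pow_ne_zero _ hp.ne_zero) hp.ne_zero).trans ?_
    push_cast
    rw [norm_pow, Padic.norm_p, one_mul]
  obtain ⟨l, hl⟩ := cauchySeq_tendsto_of_complete hcau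
  have hDn : ∀ n : ℕ, n ≠ 0 → ‖D n‖ = ‖x‖ := by
    intro n hn
    have hn' : (n : ℚ_[p]) ≠ 0 := by exact_mod_cast hn
    simp only [D]
    rw [norm_div, PadicInt.padic_norm_e_of_padicInt, norm_pow_sub_one hodd x hx, hnorm]
    have : ‖(n : ℚ_[p])‖ ≠ 0 := norm_ne_zero_iff.2 hn'
    field_simp
  refine ⟨l, ?_, ?_⟩
  · have h2 := hl.norm
    have h3 : (fun k => ‖D (p ^ k)‖) = fun _ => ‖x‖ := by
      funext k; exact hDn _ (pow_ne_zero _ hp.ne_zero)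
    rw [h3] at h2
    have h4 := tendsto_nhds_unique h2 tendsto_const_nhds
    rw [← norm_ne_zero_iff, h4]
    simpa using hx0
  · intro n
    by_cases hn : n = 0
    · simp [hn]
    have hn' : (n : ℚ_[p]) ≠ 0 := by exact_mod_cast hn
    have h2 : Tendsto (fun k => ‖D n - D (p ^ k)‖) atTop (𝓝 ‖D n - l‖) := (tendsto_const_nhds.sub hl).norm
    have hpow : Tendsto (fun k : ℕ => ‖((p ^ k : ℕ) : ℚ_[p])‖) atTop (𝓝 0) := by
      have := tendsto_pow_atTop_nhds_zero_of_lt_one (r := (p:ℝ)⁻¹) (by positivity)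
        (inv_lt_one_of_one_lt₀ (by exact_mod_cast hp.one_lt))
      refine this.congr fun k => ?_
      push_cast
      rw [norm_pow, Padic.norm_p]
    have h3 : ∀ᶠ k in atTop, ‖D n - D (p ^ k)‖ ≤ ‖(n : ℚ_[p])‖ := by
      filter_upwards [hpow.eventually_lt_const (norm_pos_iff.2 hn')] with k hk
      have hpk := pow_ne_zero k hp.ne_zero
      have e : D n - D (p ^ k) = (D (p ^ k * n) - D (p ^ k)) - (D (n * p ^ k) - D n) := by
        rw [mul_comm n]; ring
      rw [e, sub_eq_add_neg]
      refine (Padic.nonarchimedean _ _).trans (max_le ?_ ?_)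
      · exact (h1 _ _ hpk hn).trans hk.le
      · rw [norm_neg]; exact h1 _ _ hn hpk
    have h4 : ‖D n - l‖ ≤ ‖(n : ℚ_[p])‖ := le_of_tendsto h2 h3
    have e : (((1 + x) ^ n - 1 : ℤ_[p]) : ℚ_[p]) - n * l = n * (D n - l) := by
      simp only [D]; field_simp
    rw [e, norm_mul, sq]
    gcongr

theorem good_w (hodd : p ≠ 2) (m : ℕ) (hm : 0 < m) :
    ∃ x : ℤ_[p], ∃ l : ℚ_[p], ‖x‖ < 1 ∧ x ≠ 0 ∧ l ≠ 0 ∧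
      (∀ n : ℕ, ‖(((1 + x) ^ n - 1 : ℤ_[p]) : ℚ_[p]) - n * l‖ ≤ ‖(n : ℚ_[p])‖ ^ 2) ∧
      (m : ℚ_[p]) * l ≠ ((1 + x : ℤ_[p]) : ℚ_[p]) ^ m - 1 ∧
      (m : ℚ_[p]) * l * ((1 + x : ℤ_[p]) : ℚ_[p]) ^ m ≠ ((1 + x : ℤ_[p]) : ℚ_[p]) ^ m - 1 := by
  have hp : p.Prime := Fact.out
  have hp3 : 3 ≤ p := by have := hp.two_le; omega
  have hpR : (3 : ℝ) ≤ p := by exact_mod_cast hp3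
  have hp0 : (p : ℤ_[p]) ≠ 0 := by exact_mod_cast hp.ne_zero
  set x : ℤ_[p] := p ^ 2 with hxd
  have hxn : ‖x‖ = (p : ℝ)⁻¹ ^ 2 := by rw [hxd, norm_pow, PadicInt.norm_p]
  have hpi : (p : ℝ)⁻¹ < 1 := inv_lt_one_of_one_lt₀ (by linarith)
  have hpi0 : 0 < (p : ℝ)⁻¹ := by positivity
  have hxlt : ‖x‖ < (p : ℝ)⁻¹ := by rw [hxn, sq]; nlinarith
  have hx : ‖x‖ < 1 := hxlt.trans hpi
  have hx0 : x ≠ 0 := pow_ne_zero _ hp0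
  obtain ⟨l, hl0, hl⟩ := exists_log hodd x hx hx0
  by_cases hgood : (m : ℚ_[p]) * l ≠ ((1 + x : ℤ_[p]) : ℚ_[p]) ^ m - 1 ∧
      (m : ℚ_[p]) * l * ((1 + x : ℤ_[p]) : ℚ_[p]) ^ m ≠ ((1 + x : ℤ_[p]) : ℚ_[p]) ^ m - 1
  · exact ⟨x, l, hx, hx0, hl0, hl, hgood⟩
  have hw : (1 + ((1 + x) ^ 2 - 1)) = (1 + x) ^ 2 := by ring
  have h2n := norm_pow_sub_one hodd x hx 2
  have h20 : (2 : ℤ_[p]) ≠ 0 := by norm_num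
  have hyn := norm_pow_sub_one hodd x hx m
  set y : ℤ_[p] := (1 + x) ^ m - 1 with hyd
  have hy0 : y ≠ 0 := by
    rw [← norm_pos_iff, hyn]
    have : (m : ℤ_[p]) ≠ 0 := by exact_mod_cast hm.ne'
    positivity
  have hylt : ‖y‖ < (p : ℝ)⁻¹ := by
    rw [hyn]
    exact (mul_le_of_le_one_left (norm_nonneg _) (PadicInt.norm_le_one _)).trans_lt hxlt
  have h3n : (p : ℝ)⁻¹ ≤ ‖(3 : ℤ_[p])‖ := by
    by_cases h : p = 3
    · have := PadicInt.norm_p (p := p)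
      rw [← this]
      apply le_of_eq
      congr 1
      exact_mod_cast h
    · have : ‖((3:ℕ) : ℤ_[p])‖ = 1 := by
        rw [PadicInt.norm_natCast_eq_one_iff]
        exact (Nat.coprime_primes hp Nat.prime_three).2 h
      rw [show (3 : ℤ_[p]) = ((3:ℕ) : ℤ_[p]) by norm_num, this]
      exact hpi.le
  have hy3 : y + 3 ≠ 0 := by
    intro h
    rw [eq_neg_of_add_eq_zero_left h, norm_neg] at hylt
    linarith
  have hy32 : 2 * y + 3 ≠ 0 := by
    intro h
    have h' : ‖2 * y‖ < (p : ℝ)⁻¹ := by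
      rw [norm_mul]
      exact (mul_le_of_le_one_left (norm_nonneg _) (PadicInt.norm_le_one _)).trans_lt hylt
    rw [eq_neg_of_add_eq_zero_left h, norm_neg] at h'
    linarith
  have hyQ : ((1 + x : ℤ_[p]) : ℚ_[p]) ^ m = 1 + (y : ℚ_[p]) := by
    rw [hyd]; push_cast; ring
  have cne : ∀ z : ℤ_[p], z ≠ 0 → (z : ℚ_[p]) ≠ 0 := fun z hz => by simpa using hz
  have c3 : ((3 : ℤ_[p]) : ℚ_[p]) = 3 := map_ofNat PadicInt.Coe.ringHom 3
  have c2 : ((2 : ℤ_[p]) : ℚ_[p]) = 2 := map_ofNat PadicInt.Coe.ringHom 2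
  have cy0 : (y : ℚ_[p]) ≠ 0 := cne _ hy0
  have cy3 : (y : ℚ_[p]) + 3 ≠ 0 := by
    have := cne _ hy3
    rwa [PadicInt.coe_add, c3] at this
  have cy32 : 2 * (y : ℚ_[p]) + 3 ≠ 0 := by
    have := cne _ hy32
    rwa [PadicInt.coe_add, PadicInt.coe_mul, c2, c3] at this
  refine ⟨(1 + x) ^ 2 - 1, 2 * l, ?_, ?_, mul_ne_zero two_ne_zero hl0, ?_, ?_⟩
  · rw [h2n]
    exact (mul_le_of_le_one_left (norm_nonneg _) (PadicInt.norm_le_one _)).trans_lt hx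
  · rw [← norm_pos_iff, h2n]
    have : ((2:ℕ) : ℤ_[p]) ≠ 0 := by norm_num
    positivity
  · intro n
    rw [hw, ← pow_mul]
    have := hl (2 * n)
    push_cast at this ⊢
    rw [mul_comm (2 : ℚ_[p]) (n : ℚ_[p]), norm_mul] at this
    rw [← mul_assoc]
    refine this.trans ?_
    have h2 : ‖(2 : ℚ_[p])‖ ≤ 1 := by simpa using Padic.norm_int_le_one (p := p) 2
    gcongr
    exact mul_le_of_le_one_right (norm_nonneg _) h2
  · rw [hw]
    have hyQ2 : (((1 + x) ^ 2 : ℤ_[p]) : ℚ_[p]) ^ m = (1 + (y : ℚ_[p])) ^ 2 := by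
      rw [← hyQ]; push_cast; rw [← pow_mul, ← pow_mul, mul_comm]
    rw [hyQ2]
    rw [hyQ] at hgood
    set Y := (y : ℚ_[p])
    set u := (m : ℚ_[p]) * l with hu
    rw [show (m : ℚ_[p]) * (2 * l) = 2 * u by rw [hu]; ring]
    have hb : u = Y ∨ u * (1 + Y) = Y := by
      by_contra hcon
      push Not at hcon
      refine hgood ⟨fun h => hcon.1 (by linear_combination h), fun h => hcon.2 (by linear_combination h)⟩
    rcases hb with hb | hb
    · constructor
      · intro h
        have : Y * Y = 0 := by linear_combination 2 * hb - h
        simp [cy0] at this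
      · intro h
        have : Y * Y * (2 * Y + 3) = 0 := by
          linear_combination h - 2 * (1 + Y) ^ 2 * hb
        simp [cy0, cy32] at this
    · constructor
      · intro h
        have : Y * Y * (Y + 3) = 0 := by
          linear_combination 2 * hb - (1 + Y) * h
        simp [cy0, cy3] at this
      · intro h
        have : Y * Y = 0 := by
          linear_combination  h - 2 * (1 + Y) * hb
        simp [cy0] at this

theorem tendsto_p_pow : Tendsto (fun L : ℕ => (p : ℤ_[p]) ^ L) atTop (𝓝 0) := by
  apply tendsto_pow_atTop_nhds_zero_of_norm_lt_one
  rw [PadicInt.norm_p]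
  exact inv_lt_one_of_one_lt₀ (by exact_mod_cast (Fact.out : p.Prime).one_lt)

theorem tendsto_poly (f : ℤ_[p][X]) (v : ℤ_[p]) :
    Tendsto (fun L : ℕ => ((f.eval ((p : ℤ_[p]) ^ L * v) : ℤ_[p]) : ℚ_[p])) atTop
      (𝓝 ((f.eval 0 : ℤ_[p]) : ℚ_[p])) := by
  have h1 : Tendsto (fun L : ℕ => (p : ℤ_[p]) ^ L * v) atTop (𝓝 0) := by
    simpa using tendsto_p_pow.mul_const v
  exact (continuous_subtype_val.tendsto _).comp ((f.continuous.tendsto 0).comp h1)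

theorem core (hodd : p ≠ 2) (c0 : ℤ_[p]) (hc0 : c0 ≠ 0) (m : ℕ) (hm : 0 < m) (e h : ℤ_[p][X])
    (he : e.eval 0 ≠ 0) (hh : h = C c0 + X ^ m * e) :
    ∀ᶠ L : ℕ in atTop, h.eval ((p : ℤ_[p]) ^ L) ≠ 0 ∧ ∃ M : ℕ, 0 < M ∧ ∃ z₁ z₂ : ℤ_[p], z₁ ≠ z₂ ∧
      ∀ z, (z = z₁ ∨ z = z₂) → ‖z - 1‖ < 1 ∧
        z ^ M * h.eval ((p : ℤ_[p]) ^ L * z) = h.eval ((p : ℤ_[p]) ^ L) ∧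
        M * z ^ (M - 1) * h.eval ((p : ℤ_[p]) ^ L * z) +
          z ^ M * ((p : ℤ_[p]) ^ L * h.derivative.eval ((p : ℤ_[p]) ^ L * z)) ≠ 0 := by
  obtain ⟨x, l, hx, hx0, hl0, hl, hg1, hg2⟩ := good_w hodd m hm
  have hp0 : (p : ℤ_[p]) ≠ 0 := by exact_mod_cast (Fact.out : p.Prime).ne_zero
  set w : ℤ_[p] := 1 + x with hw
  have hwn : ‖w‖ = 1 := by
    have := PadicInt.norm_add_eq_max_of_ne (q := (1 : ℤ_[p])) (r := x) (by rw [norm_one]; exact hx.ne')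
    rw [hw, this, norm_one, max_eq_left hx.le]
  let P : ℕ → ℤ_[p] := fun L => (p : ℤ_[p]) ^ L
  let A : ℕ → ℤ_[p] := fun L => P L ^ m
  have hP0 : ∀ L, P L ≠ 0 := fun L => pow_ne_zero _ hp0
  have hA0 : ∀ L, A L ≠ 0 := fun L => pow_ne_zero _ (hP0 L)
  have hAQ0 : ∀ L, (A L : ℚ_[p]) ≠ 0 := fun L => by simpa using hA0 L
  have hAt : Tendsto A atTop (𝓝 0) := by
    have := (tendsto_p_pow (p := p)).pow m
    rwa [zero_pow hm.ne'] at this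
  have hAQt : Tendsto (fun L => (A L : ℚ_[p])) atTop (𝓝 0) :=
    (continuous_subtype_val.tendsto _).comp hAt
  have hAn : Tendsto (fun L => ‖A L‖) atTop (𝓝 0) := by simpa using hAt.norm
  have hh0 : h.eval 0 = c0 := by simp [hh, hm.ne']
  have hev : ∀ v L, h.eval (P L * v) = c0 + A L * (v ^ m * e.eval (P L * v)) := by
    intro v L; simp [hh, A, mul_pow]; ring
  have hdev : ∀ v L, P L * v * h.derivative.eval (P L * v) =
      A L * (v ^ m * (m * e.eval (P L * v) + P L * v * e.derivative.eval (P L * v))) := by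
    intro v L
    obtain ⟨k, rfl⟩ : ∃ k, m = k + 1 := ⟨m - 1, by omega⟩
    simp [hh, A, mul_pow]; ring
  -- choice of M
  have hc0n : 0 < ‖c0‖ := norm_pos_iff.2 hc0
  have hxn : 0 < ‖x‖ := norm_pos_iff.2 hx0
  have hsmall : ∀ᶠ L in atTop, ‖A L‖ < ‖c0‖ * ‖x‖ := hAn.eventually_lt_const (by positivity)
  have hval : ∀ L, ‖A L‖ < ‖c0‖ * ‖x‖ → ∀ v, ‖h.eval (P L * v)‖ = ‖c0‖ := by
    intro L hL v
    rw [hev]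
    have h1 : ‖A L * (v ^ m * e.eval (P L * v))‖ < ‖c0‖ := by
      rw [norm_mul]
      refine (mul_le_of_le_one_right (norm_nonneg _) (PadicInt.norm_le_one _)).trans_lt (hL.trans ?_)
      exact mul_lt_of_lt_one_right hc0n hx
    rw [PadicInt.norm_add_eq_max_of_ne h1.ne', max_eq_left h1.le]
  have hMex : ∀ᶠ L in atTop, ∃ M : ℕ, 0 < M ∧
      ‖w ^ M * h.eval (P L * w) - h.eval (P L * 1)‖ ≤ ‖A L‖ ^ 3 := by
    filter_upwards [hsmall] with L hL
    have hvw := hval L hL w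
    have hne : h.eval (P L * w) ≠ 0 := by rw [← norm_pos_iff, hvw]; exact hc0n
    have hdiff : ‖h.eval (P L * 1) - h.eval (P L * w)‖ ≤ ‖h.eval (P L * w) * x‖ := by
      rw [norm_mul, hvw]
      refine le_trans ?_ hL.le
      rw [hev, hev, add_sub_add_left_eq_sub, ← mul_sub, norm_mul]
      exact mul_le_of_le_one_right (norm_nonneg _) (PadicInt.norm_le_one _)
    obtain ⟨y, hy⟩ := dvd_of_norm_le (mul_ne_zero hne hx0) hdiff
    obtain ⟨M, hM, hMb⟩ := exists_pow hodd x hx hx0 (1 + x * y) (by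
      rw [add_sub_cancel_left, norm_mul]
      exact mul_le_of_le_one_right (norm_nonneg _) (PadicInt.norm_le_one _)) (L * m * 3)
    refine ⟨M, hM, ?_⟩
    have e1 : w ^ M * h.eval (P L * w) - h.eval (P L * 1) =
        h.eval (P L * w) * ((1 + x) ^ M - (1 + x * y)) := by
      linear_combination -hy
    rw [e1, norm_mul]
    have e2 : ‖A L‖ ^ 3 = (p : ℝ)⁻¹ ^ (L * m * 3) := by
      simp only [A, P]
      rw [norm_pow, norm_pow, PadicInt.norm_p, ← pow_mul, ← pow_mul, mul_assoc]
    rw [e2]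
    calc _ ≤ 1 * (‖x‖ * ((p : ℝ)⁻¹) ^ (L * m * 3)) := by
            gcongr
            exact PadicInt.norm_le_one _
      _ ≤ 1 * (1 * ((p : ℝ)⁻¹) ^ (L * m * 3)) := by gcongr
      _ = _ := by ring
  obtain ⟨M, hM⟩ := hMex.choice
  -- limits
  have tw := tendsto_poly h w
  have t1 := tendsto_poly h (1 : ℤ_[p])
  have tew := tendsto_poly e w
  have te1 := tendsto_poly e (1 : ℤ_[p])
  have tdw := tendsto_poly (X * derivative e) w
  have td1 := tendsto_poly (X * derivative e) (1 : ℤ_[p])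
  rw [hh0] at tw t1
  have hc0Q : (c0 : ℚ_[p]) ≠ 0 := by simpa using hc0
  set E : ℚ_[p] := ((e.eval 0 : ℤ_[p]) : ℚ_[p]) with hE
  have hE0 : E ≠ 0 := by rw [hE]; simpa using he
  set W : ℚ_[p] := (w : ℚ_[p]) ^ m with hW
  let Xs : ℕ → ℚ_[p] := fun L => ((w ^ M L - 1 : ℤ_[p]) : ℚ_[p]) / A L
  let ε : ℕ → ℚ_[p] := fun L => ((w ^ M L * h.eval (P L * w) - h.eval (P L * 1) : ℤ_[p]) : ℚ_[p]) / A L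
  have hε : Tendsto ε atTop (𝓝 0) := by
    apply squeeze_zero_norm' (a := fun L => ‖A L‖ ^ 2)
    · filter_upwards [hM] with L hL
      simp only [ε]
      rw [norm_div, PadicInt.padic_norm_e_of_padicInt, PadicInt.padic_norm_e_of_padicInt]
      have : 0 < ‖A L‖ := norm_pos_iff.2 (hA0 L)
      rw [div_le_iff₀ this]
      calc _ ≤ _ := hL.2
        _ = _ := by ring
    · simpa using hAn.pow 2
  have hXs : Tendsto Xs atTop (𝓝 (-((W - 1) * E) / c0)) := by
    have l1 : Tendsto (fun L => (ε L - (W * ((e.eval (P L * w) : ℤ_[p]) : ℚ_[p])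
        - ((e.eval (P L * 1) : ℤ_[p]) : ℚ_[p]))) / ((h.eval (P L * w) : ℤ_[p]) : ℚ_[p])) atTop
        (𝓝 ((0 - (W * E - E)) / c0)) :=
      (hε.sub ((tew.const_mul W).sub te1)).div tw hc0Q
    have e1 : (0 - (W * E - E)) / (c0 : ℚ_[p]) = -((W - 1) * E) / c0 := by ring
    rw [e1] at l1
    refine l1.congr' ?_
    filter_upwards [hsmall] with L hL
    have hne : h.eval (P L * w) ≠ 0 := by rw [← norm_pos_iff, hval L hL w]; exact hc0n
    have hneQ : ((h.eval (P L * w) : ℤ_[p]) : ℚ_[p]) ≠ 0 := by simpa using hne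
    have i1 := congrArg (fun z : ℤ_[p] => (z : ℚ_[p])) (hev w L)
    have i2 := congrArg (fun z : ℤ_[p] => (z : ℚ_[p])) (hev 1 L)
    simp only [PadicInt.coe_add, PadicInt.coe_mul, PadicInt.coe_pow, one_pow, one_mul, ← hW] at i1 i2
    have hAL := hAQ0 L
    rw [div_eq_iff hneQ]
    simp only [Xs, ε]
    rw [PadicInt.coe_sub, PadicInt.coe_sub, PadicInt.coe_mul, PadicInt.coe_one]
    generalize ((eval (P L * w) e : ℤ_[p]) : ℚ_[p]) = ew at *
    generalize ((eval (P L * 1) e : ℤ_[p]) : ℚ_[p]) = e1 at *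
    field_simp
    linear_combination i1 - i2
  have hnorm : ∀ n : ℕ, ‖(n : ℤ_[p])‖ = ‖(n : ℚ_[p])‖ := fun n => by
    rw [← PadicInt.coe_natCast, PadicInt.padic_norm_e_of_padicInt]
  have hMl : Tendsto (fun L => (M L : ℚ_[p]) * l / A L) atTop (𝓝 (-((W - 1) * E) / c0)) := by
    have l0 : Tendsto (fun L => Xs L - (M L : ℚ_[p]) * l / A L) atTop (𝓝 0) := by
      apply squeeze_zero_norm (a := fun L => ‖Xs L‖ ^ 2 * ‖A L‖ / ‖x‖ ^ 2)
      · intro L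
        have e1 : Xs L - (M L : ℚ_[p]) * l / A L = ((((1 + x) ^ M L - 1 : ℤ_[p]) : ℚ_[p]) - M L * l) / A L := by
          simp only [Xs]; rw [sub_div]
        have hAp : 0 < ‖A L‖ := norm_pos_iff.2 (hA0 L)
        rw [e1, norm_div, PadicInt.padic_norm_e_of_padicInt (A L), div_le_iff₀ hAp]
        refine (hl (M L)).trans (le_of_eq ?_)
        simp only [Xs]
        rw [norm_div, PadicInt.padic_norm_e_of_padicInt, PadicInt.padic_norm_e_of_padicInt, hw,
          norm_pow_sub_one hodd x hx, hnorm]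
        field_simp
      · have := ((hXs.norm.pow 2).mul hAn).div_const (‖x‖ ^ 2)
        simpa using this
    have := hXs.sub l0
    simpa using this
  have hMA : Tendsto (fun L => (M L : ℚ_[p]) / A L) atTop (𝓝 (-((W - 1) * E) / c0 / l)) := by
    refine (hMl.div_const l).congr fun L => ?_
    have := hAQ0 L
    field_simp
  -- the derivative, up to a unit
  let Q : ℤ_[p] → ℕ → ℤ_[p] := fun v L => M L * h.eval (P L * v) + P L * v * h.derivative.eval (P L * v)
  have hQ : ∀ v : ℤ_[p], Tendsto (fun L => ((Q v L : ℤ_[p]) : ℚ_[p]) / A L) atTop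
      (𝓝 (E / l * (m * l * (v : ℚ_[p]) ^ m - (W - 1)))) := by
    intro v
    have l1 := (hMA.mul (tendsto_poly h v)).add
      ((((tendsto_poly e v).const_mul (m : ℚ_[p])).add (tendsto_poly (X * derivative e) v)).const_mul ((v : ℚ_[p]) ^ m))
    rw [hh0] at l1
    have e1 : -((W - 1) * E) / c0 / l * c0 + (v : ℚ_[p]) ^ m * (m * E + ((eval 0 (X * derivative e) : ℤ_[p]) : ℚ_[p])) =
       (E / l * (m * l * (v : ℚ_[p]) ^ m - (W - 1))) := by
      simp
      field_simp
      ring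
    rw [← e1]
    refine l1.congr fun L => ?_
    simp only [Q]
    rw [hdev]
    have := hAQ0 L
    simp only [eval_mul, eval_X, PadicInt.coe_add, PadicInt.coe_mul, PadicInt.coe_pow, PadicInt.coe_natCast]
    simp only [P] at *
    push_cast
    field_simp
  have hκ1 : E / l * (m * l * ((1 : ℤ_[p]) : ℚ_[p]) ^ m - (W - 1)) ≠ 0 := by
    rw [PadicInt.coe_one, one_pow, mul_one]
    exact mul_ne_zero (div_ne_zero hE0 hl0) (sub_ne_zero.2 hg1)
  have hκ2 : E / l * (m * l * (w : ℚ_[p]) ^ m - (W - 1)) ≠ 0 :=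
    mul_ne_zero (div_ne_zero hE0 hl0) (sub_ne_zero.2 hg2)
  set κ := E / l * (m * l * (w : ℚ_[p]) ^ m - (W - 1)) with hκ
  have hκn : 0 < ‖κ‖ := norm_pos_iff.2 hκ2
  have ev1 : ∀ᶠ L in atTop, Q 1 L ≠ 0 := by
    filter_upwards [(hQ 1).eventually_ne hκ1] with L hL h0
    simp [h0] at hL
  have ev2 : ∀ᶠ L in atTop, ‖κ‖ / 2 < ‖((Q w L : ℤ_[p]) : ℚ_[p]) / A L‖ :=
    (hQ w).norm.eventually_const_lt (by linarith)
  have ev3 : ∀ᶠ L in atTop, ‖((Q w L : ℤ_[p]) : ℚ_[p]) / A L‖ < ‖κ‖ + 1 :=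
    (hQ w).norm.eventually_lt_const (by linarith)
  have ev4 : ∀ᶠ L in atTop, ‖A L‖ < (‖κ‖ / 2) ^ 2 := hAn.eventually_lt_const (by positivity)
  have ev5 : ∀ᶠ L in atTop, ‖A L‖ < ‖x‖ / (‖κ‖ + 1) := hAn.eventually_lt_const (by positivity)
  filter_upwards [hM, hsmall, ev1, ev2, ev3, ev4, ev5] with L ⟨hM0, hMb⟩ hs h1 h2 h3 h4 h5
  have hAp : 0 < ‖A L‖ := norm_pos_iff.2 (hA0 L)
  rw [norm_div, PadicInt.padic_norm_e_of_padicInt, PadicInt.padic_norm_e_of_padicInt] at h2 h3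
  rw [lt_div_iff₀ hAp] at h2
  rw [div_lt_iff₀ hAp] at h3
  rw [lt_div_iff₀ (by positivity)] at h5
  let F : ℤ_[p][X] := X ^ (M L) * h.comp (C (P L) * X) - C (h.eval (P L * 1))
  have hF : ∀ z, F.aeval z = z ^ M L * h.eval (P L * z) - h.eval (P L * 1) := by
    intro z; simp [F]
  have hF' : ∀ z, F.derivative.aeval z = M L * z ^ (M L - 1) * h.eval (P L * z) +
          z ^ M L * (P L * h.derivative.eval (P L * z)) := by
    intro z; simp [F, derivative_comp, derivative_X_pow]
  have hF'Q : ∀ z, F.derivative.aeval z = z ^ (M L - 1) * Q z L := by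
    intro z
    rw [hF']
    simp only [Q]
    obtain ⟨k, hk⟩ : ∃ k, M L = k + 1 := ⟨M L - 1, by omega⟩
    rw [hk, Nat.add_sub_cancel]
    ring
  have hFwn : ‖F.derivative.aeval w‖ = ‖Q w L‖ := by
    rw [hF'Q, norm_mul, norm_pow, hwn, one_pow, one_mul]
  obtain ⟨z, hz, hzw, hz', -⟩ := hensels_lemma (F := F) (a := w) (by
    rw [hFwn, hF]
    refine hMb.trans_lt ?_
    calc ‖A L‖ ^ 3 = ‖A L‖ * ‖A L‖ ^ 2 := by ring
      _ < (‖κ‖ / 2) ^ 2 * ‖A L‖ ^ 2 := by gcongr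
      _ = (‖κ‖ / 2 * ‖A L‖) ^ 2 := by ring
      _ < ‖Q w L‖ ^ 2 := by gcongr)
  rw [hFwn] at hzw hz'
  have hzx : ‖z - w‖ < ‖x‖ := by
    refine hzw.trans (h3.trans ?_)
    linarith
  refine ⟨?_, M L, hM0, 1, z, ?_, ?_⟩
  · have := hval L hs 1
    rw [mul_one] at this
    rw [← norm_pos_iff]
    change 0 < ‖eval (P L) h‖
    rw [this]; exact hc0n
  · rintro rfl
    rw [hw, sub_add_cancel_left, norm_neg] at hzx
    exact lt_irrefl _ hzx
  · rintro y (rfl | rfl)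
    · refine ⟨by simp, by simp, ?_⟩
      have := hF'Q 1
      rw [hF'] at this
      change _ * _ * eval (P L * 1) h + 1 ^ M L * (P L * eval (P L * 1) (derivative h)) ≠ 0
      rw [this]
      simpa using h1
    · refine ⟨?_, ?_, ?_⟩
      · have : y - 1 = (y - w) + x := by rw [hw]; ring
        rw [this]
        exact PadicInt.norm_lt_one_add (hzx.trans hx) hx
      · rw [hF, mul_one] at hz
        exact sub_eq_zero.1 hz
      · change _ * _ * eval (P L * y) h + y ^ M L * (P L * eval (P L * y) (derivative h)) ≠ 0
        rw [← hF', ← norm_pos_iff, hz']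
        exact (norm_nonneg _).trans_lt hzw

theorem norm_deriv_le (h : ℤ_[p][X]) (r s : ℤ_[p]) (hr : h.eval r = 0) (hs : h.eval s = 0)
    (hne : r ≠ s) : ‖h.derivative.eval r‖ ≤ ‖r - s‖ := by
  obtain ⟨k, hk⟩ := h.binomExpansion r (s - r)
  rw [add_sub_cancel, hs, hr] at hk
  have hsr : s - r ≠ 0 := sub_ne_zero.2 hne.symm
  have : h.derivative.eval r = (r - s) * k := by
    apply mul_right_cancel₀ hsr
    linear_combination -hk
  rw [this, norm_mul]
  exact mul_le_of_le_one_right (norm_nonneg _) (PadicInt.norm_le_one _)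

theorem fewnomial (hodd : p ≠ 2) (d : ℕ) (hd : 0 < d) (t : ℕ) :
    ∃ (h : ℤ_[p][X]) (c0 : ℤ_[p]) (m : ℕ) (e : ℤ_[p][X]), c0 ≠ 0 ∧ 0 < m ∧ e.eval 0 ≠ 0 ∧
      h = C c0 + X ^ m * e ∧ h.support.card ≤ t + 2 ∧ ∃ S : Finset ℤ_[p], S.card = 2 * t + 1 ∧
      ∀ r ∈ S, h.eval r = 0 ∧ h.derivative.eval r ≠ 0 ∧
        ∃ (l : ℕ) (u : ℤ_[p]), r = (p : ℤ_[p]) ^ (d * l) * u ∧ ‖u - 1‖ < 1 := by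
  classical
  have hp0 : (p : ℤ_[p]) ≠ 0 := by exact_mod_cast (Fact.out : p.Prime).ne_zero
  have hunit : ∀ u : ℤ_[p], ‖u - 1‖ < 1 → ‖u‖ = 1 := by
    intro u hu
    have := PadicInt.norm_add_eq_max_of_ne (q := (1 : ℤ_[p])) (r := u - 1) (by rw [norm_one]; exact hu.ne')
    rw [add_sub_cancel, norm_one, max_eq_left hu.le] at this
    exact this
  have hsupp : ∀ (c : ℤ_[p]) (M : ℕ) (f : ℤ_[p][X]), (C c + X ^ M * f).support.card ≤ f.support.card + 1 := by
    intro c M f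
    have h1 : (X ^ M * f).support.card ≤ f.support.card := by
      refine (card_support_mul_le).trans ?_
      have : (X ^ M : ℤ_[p][X]).support.card ≤ 1 := by
        rw [← monomial_one_right_eq_X_pow]
        exact (Finset.card_le_card (support_monomial_subset M 1)).trans (by simp)
      nlinarith
    have h2 : (C c : ℤ_[p][X]).support.card ≤ 1 :=
      (Finset.card_le_card (support_C_subset c)).trans (by simp)
    refine (Finset.card_le_card support_add).trans ((Finset.card_union_le _ _).trans ?_)
    omega
  induction t with
  | zero =>
    refine ⟨C 1 + X ^ 1 * C (-1), 1, 1, C (-1), one_ne_zero, one_pos, by simp, rfl, ?_, {1}, by simp, ?_⟩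
    · refine (hsupp _ _ _).trans ?_
      have h2 : (C (-1) : ℤ_[p][X]).support.card ≤ 1 :=
        (Finset.card_le_card (support_C_subset _)).trans (by simp)
      omega
    · intro r hr
      rw [Finset.mem_singleton] at hr
      subst hr
      exact ⟨by simp, by simp, 0, 1, by simp, by simp⟩
  | succ t ih =>
    obtain ⟨h, c0, m, e, hc0, hm, he, hh, hcard, S, hS, hroots⟩ := ih
    have hrne : ∀ r ∈ S, r ≠ 0 := by
      intro r hr
      obtain ⟨-, -, l, u, rfl, hu⟩ := hroots r hr
      refine mul_ne_zero (pow_ne_zero _ hp0) ?_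
      rw [← norm_pos_iff, hunit u hu]; exact one_pos
    have hcore := core hodd c0 hc0 m hm e h he hh
    have hsm : ∀ᶠ L : ℕ in atTop, ∀ r ∈ S, ‖(p : ℤ_[p]) ^ L‖ < ‖r‖ ^ 2 * ‖h.derivative.eval r‖ ^ 2 := by
      rw [Filter.eventually_all_finset]
      intro r hr
      have hpos : 0 < ‖r‖ ^ 2 * ‖h.derivative.eval r‖ ^ 2 := by
        have h1 := norm_pos_iff.2 (hrne r hr)
        have h2 := norm_pos_iff.2 (hroots r hr).2.1
        positivity
      have := (tendsto_p_pow (p := p)).norm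
      rw [norm_zero] at this
      exact this.eventually_lt_const hpos
    have hdt : Tendsto (fun L : ℕ => d * L) atTop atTop := tendsto_id.const_mul_atTop' hd
    obtain ⟨L, ⟨hne, M, hM, z₁, z₂, hz12, hz⟩, hsmL⟩ := (hdt.eventually (hcore.and hsm)).exists
    set π : ℤ_[p] := (p : ℤ_[p]) ^ (d * L) with hπ
    have hπ0 : π ≠ 0 := pow_ne_zero _ hp0
    set c : ℤ_[p] := -(π ^ M * h.eval π) with hc
    have hcne : c ≠ 0 := neg_ne_zero.2 (mul_ne_zero (pow_ne_zero _ hπ0) hne)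
    set G : ℤ_[p][X] := C c + X ^ M * h with hG
    have hGe : ∀ y, G.eval y = c + y ^ M * h.eval y := by intro y; simp [hG]
    have hGd : ∀ y, G.derivative.eval y = M * y ^ (M - 1) * h.eval y + y ^ M * h.derivative.eval y := by
      intro y; simp [hG, derivative_X_pow]
    have hold : ∀ r, ∃ r', r ∈ S → (G.eval r' = 0 ∧ G.derivative.eval r' ≠ 0 ∧
        ‖r' - r‖ < ‖h.derivative.eval r‖ ∧ ‖r' - r‖ < ‖r‖) := by
      intro r
      by_cases hr : r ∈ S
      swap
      · exact ⟨0, fun h => absurd h hr⟩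
      have hr0 := hroots r hr
      have h1 : G.eval r = c := by rw [hGe, hr0.1]; simp
      have h2 : G.derivative.eval r = r ^ M * h.derivative.eval r := by rw [hGd, hr0.1]; simp
      have hlt : ‖G.eval r‖ < ‖G.derivative.eval r‖ ^ 2 := by
        rw [h1, h2, hc, norm_neg, norm_mul, norm_mul, norm_pow π M, norm_pow r M]
        calc ‖π‖ ^ M * ‖h.eval π‖ ≤ ‖π‖ ^ M :=
              mul_le_of_le_one_right (by positivity) (PadicInt.norm_le_one _)
          _ < (‖r‖ ^ 2 * ‖h.derivative.eval r‖ ^ 2) ^ M := by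
              have := hsmL r hr
              gcongr
          _ = (‖r‖ ^ M) ^ 2 * (‖h.derivative.eval r‖ ^ 2) ^ M := by rw [mul_pow]; congr 1; ring
          _ ≤ (‖r‖ ^ M) ^ 2 * (‖h.derivative.eval r‖ ^ 2) := by
              gcongr
              apply pow_le_of_le_one (by positivity) _ hM.ne'
              exact pow_le_one₀ (norm_nonneg _) (PadicInt.norm_le_one _)
          _ = _ := by ring
      obtain ⟨z, q1, q2, q3, -⟩ := hensels_lemma (F := G) (a := r) (by simpa using hlt)
      simp only [coe_aeval_eq_eval] at q1 q2 q3
      have hn2 : ‖G.derivative.eval r‖ = ‖r‖ ^ M * ‖h.derivative.eval r‖ := by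
        rw [h2, norm_mul, norm_pow]
      refine ⟨z, fun _ => ⟨q1, ?_, ?_, ?_⟩⟩
      · rw [← norm_pos_iff, q3]; exact (norm_nonneg _).trans_lt q2
      · refine q2.trans_le ?_
        rw [hn2]
        exact mul_le_of_le_one_left (norm_nonneg _) (pow_le_one₀ (norm_nonneg _) (PadicInt.norm_le_one _))
      · refine q2.trans_le ?_
        rw [hn2]
        exact (mul_le_of_le_one_right (by positivity) (PadicInt.norm_le_one _)).trans
          (pow_le_of_le_one (norm_nonneg _) (PadicInt.norm_le_one _) hM.ne')
    choose f hf using hold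
    have hfn : ∀ r ∈ S, ‖f r‖ = ‖r‖ := by
      intro r hr
      have h1 := (hf r hr).2.2.2
      have := PadicInt.norm_add_eq_max_of_ne (q := r) (r := f r - r) h1.ne'
      rwa [add_sub_cancel, max_eq_left h1.le] at this
    have hπr : ∀ r ∈ S, ‖π‖ < ‖r‖ := by
      intro r hr
      refine (hsmL r hr).trans_le ?_
      refine (mul_le_of_le_one_right (by positivity) (pow_le_one₀ (norm_nonneg _) (PadicInt.norm_le_one _))).trans ?_
      exact pow_le_of_le_one (norm_nonneg _) (PadicInt.norm_le_one _) two_ne_zero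
    have hinj : Set.InjOn f S := by
      intro r hr s hs hrs
      by_contra hne'
      have h1 := norm_deriv_le h r s (hroots r hr).1 (hroots s hs).1 hne'
      have h2 := norm_deriv_le h s r (hroots s hs).1 (hroots r hr).1 (Ne.symm hne')
      have h3 := (hf r hr).2.2.1.trans_le h1
      have h4 := (hf s hs).2.2.1.trans_le h2
      rw [norm_sub_rev s r] at h4
      have : r - s = (f s - s) - (f r - r) := by rw [hrs]; ring
      have h5 := norm_sub_le_max' (f s - s) (f r - r)
      rw [← this] at h5
      exact absurd (h5.trans_lt (max_lt h4 h3)) (lt_irrefl _)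
    have hzn : ∀ z, (z = z₁ ∨ z = z₂) → ‖π * z‖ = ‖π‖ := by
      intro z h'
      rw [norm_mul, hunit z (hz z h').1, mul_one]
    have hdisj : Disjoint (S.image f) {π * z₁, π * z₂} := by
      rw [Finset.disjoint_left]
      intro y hy hy'
      rw [Finset.mem_image] at hy
      obtain ⟨r, hr, rfl⟩ := hy
      have h1 := hfn r hr
      have h2 := hπr r hr
      rw [Finset.mem_insert, Finset.mem_singleton] at hy'
      rcases hy' with hy' | hy'
      · rw [hy', hzn _ (Or.inl rfl)] at h1; linarith
      · rw [hy', hzn _ (Or.inr rfl)] at h1; linarith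
    refine ⟨G, c, M, h, hcne, hM, ?_, rfl, ?_, S.image f ∪ {π * z₁, π * z₂}, ?_, ?_⟩
    · simp [hh, hm.ne', hc0]
    · exact (hsupp _ _ _).trans (by omega)
    · rw [Finset.card_union_of_disjoint hdisj, Finset.card_image_of_injOn hinj, hS, Finset.card_pair]
      · ring
      · intro h'; exact hz12 (mul_left_cancel₀ hπ0 h')
    · intro y hy
      rw [Finset.mem_union] at hy
      rcases hy with hy | hy
      · rw [Finset.mem_image] at hy
        obtain ⟨r, hr, rfl⟩ := hy
        obtain ⟨g1, g2, g3, g4⟩ := hf r hr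
        refine ⟨g1, g2, ?_⟩
        obtain ⟨-, -, l, u, hru, hu⟩ := hroots r hr
        have hpl : (p : ℤ_[p]) ^ (d * l) ≠ 0 := pow_ne_zero _ hp0
        have hrn : ‖r‖ = ‖(p : ℤ_[p]) ^ (d * l)‖ := by rw [hru, norm_mul, hunit u hu, mul_one]
        rw [hrn] at g4
        obtain ⟨s, hs⟩ := dvd_of_norm_le hpl g4.le
        refine ⟨l, u + s, ?_, ?_⟩
        · rw [mul_add, ← hru, ← hs]; ring
        · have : ‖s‖ < 1 := by
            rw [hs, norm_mul] at g4
            have := norm_pos_iff.2 hpl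
            nlinarith
          rw [show u + s - 1 = (u - 1) + s by ring]
          exact PadicInt.norm_lt_one_add hu this
      · have hy' : ∃ z, (z = z₁ ∨ z = z₂) ∧ y = π * z := by
          rw [Finset.mem_insert, Finset.mem_singleton] at hy
          rcases hy with hy | hy
          · exact ⟨z₁, Or.inl rfl, hy⟩
          · exact ⟨z₂, Or.inr rfl, hy⟩
        obtain ⟨z, hzz, rfl⟩ := hy'
        obtain ⟨k1, k2, k3⟩ := hz z hzz
        refine ⟨?_, ?_, L, z, rfl, k1⟩
        · rw [hGe, hc, mul_pow, mul_assoc, k2]; ring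
        · intro h0
          apply k3
          rw [hGd] at h0
          have : π ^ (M - 1) * (M * z ^ (M - 1) * h.eval (π * z) +
              z ^ M * (π * h.derivative.eval (π * z))) = 0 := by
            rw [← h0]
            obtain ⟨k, rfl⟩ : ∃ k, M = k + 1 := ⟨M - 1, by omega⟩
            rw [Nat.add_sub_cancel]
            ring
          exact (mul_eq_zero.1 this).resolve_left (pow_ne_zero _ hπ0)

theorem one_add_pow_expand {K : Type*} [NormedField K] [IsUltrametricDist K] (y : K) (hy : ‖y‖ ≤ 1)
    (n : ℕ) : ∃ k : K, ‖k‖ ≤ 1 ∧ (1 + y) ^ n = 1 + n * y + k * y ^ 2 := by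
  induction n with
  | zero => exact ⟨0, by simp, by simp⟩
  | succ n ih =>
    obtain ⟨k, hk, h⟩ := ih
    refine ⟨n + k + k * y, ?_, ?_⟩
    · refine (IsUltrametricDist.norm_add_le_max _ _).trans (max_le ?_ ?_)
      · exact (IsUltrametricDist.norm_add_le_max _ _).trans
          (max_le (IsUltrametricDist.norm_natCast_le_one K n) hk)
      · rw [norm_mul]; exact mul_le_one₀ hk (norm_nonneg _) hy
    · rw [pow_succ, h]; push_cast; ring

theorem norm_eq_one_of_sub {K : Type*} [NormedField K] [IsUltrametricDist K] (u : K)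
    (hu : ‖u - 1‖ < 1) : ‖u‖ = 1 := by
  have := IsUltrametricDist.norm_add_eq_max_of_norm_ne_norm (x := (1 : K)) (y := u - 1)
    (by rw [norm_one]; exact hu.ne')
  rw [add_sub_cancel, norm_one, max_eq_left hu.le] at this
  exact this

theorem teich {K : Type*} [NormedField K] [CompleteSpace K] [IsUltrametricDist K] (q : ℕ)
    (hq2 : 2 ≤ q) (hq : ‖(q : K)‖ < 1) (a : K) (ha : ‖a ^ (q - 1) - 1‖ < 1) :
    ∃ ζ : K, ζ ^ (q - 1) = 1 ∧ ‖ζ - a‖ < 1 := by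
  set y0 : ℝ := ‖a ^ (q - 1) - 1‖ with hy0
  set ρ : ℝ := max ‖(q : K)‖ y0 with hρ
  have hρ1 : ρ < 1 := max_lt hq ha
  have hy00 : 0 ≤ y0 := norm_nonneg _
  have hρ0 : 0 ≤ ρ := hy00.trans (le_max_right _ _)
  have hq1 : q - 1 ≠ 0 := by omega
  have han : ‖a‖ = 1 := by
    have := norm_eq_one_of_sub _ ha
    rw [norm_pow] at this
    exact (pow_eq_one_iff_of_nonneg (norm_nonneg _) hq1).1 this
  let b : ℕ → K := fun n => a ^ (q ^ n)
  have hb : ∀ n, b (n + 1) = b n ^ q := by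
    intro n; simp only [b]; rw [pow_succ, pow_mul]
  have hbn : ∀ n, ‖b n‖ = 1 := by intro n; simp [b, han]
  have hy : ∀ n, ‖b n ^ (q - 1) - 1‖ ≤ y0 * ρ ^ n := by
    intro n
    induction n with
    | zero => simp [b, hy0]
    | succ n ih =>
      set y := b n ^ (q - 1) - 1 with hyd
      have hyy0 : ‖y‖ ≤ y0 := ih.trans (mul_le_of_le_one_right hy00 (pow_le_one₀ hρ0 hρ1.le))
      obtain ⟨k, hk, hexp⟩ := one_add_pow_expand y (hyy0.trans ha.le) q
      have e1 : b (n + 1) ^ (q - 1) - 1 = (q + k * y) * y := by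
        have : b (n + 1) ^ (q - 1) = (1 + y) ^ q := by
          rw [hb, hyd, add_sub_cancel, pow_right_comm]
        rw [this, hexp]; ring
      rw [e1, norm_mul, pow_succ, ← mul_assoc, mul_comm (y0 * ρ ^ n)]
      refine mul_le_mul ?_ ih (norm_nonneg _) hρ0
      refine (IsUltrametricDist.norm_add_le_max _ _).trans (max_le_max le_rfl ?_)
      rw [norm_mul]
      exact (mul_le_of_le_one_left (norm_nonneg _) hk).trans hyy0
  have hdiff : ∀ n, ‖b (n + 1) - b n‖ ≤ y0 * ρ ^ n := by
    intro n
    have : b (n + 1) - b n = b n * (b n ^ (q - 1) - 1) := by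
      rw [hb]
      obtain ⟨k, rfl⟩ : ∃ k, q = k + 1 := ⟨q - 1, by omega⟩
      rw [Nat.add_sub_cancel]; ring
    rw [this, norm_mul, hbn, one_mul]
    exact hy n
  have hc : CauchySeq b := by
    apply cauchySeq_of_le_geometric ρ y0 hρ1
    intro n
    rw [dist_comm, dist_eq_norm]
    exact hdiff n
  obtain ⟨ζ, hζ⟩ := cauchySeq_tendsto_of_complete hc
  refine ⟨ζ, ?_, ?_⟩
  · have h1 : Tendsto (fun n => b n ^ (q - 1) - 1) atTop (𝓝 (ζ ^ (q - 1) - 1)) :=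
      (hζ.pow _).sub_const 1
    have h2 : Tendsto (fun n => b n ^ (q - 1) - 1) atTop (𝓝 0) := by
      apply squeeze_zero_norm hy
      simpa using (tendsto_pow_atTop_nhds_zero_of_lt_one hρ0 hρ1).const_mul y0
    exact sub_eq_zero.1 (tendsto_nhds_unique h1 h2)
  · have hba : ∀ n, ‖b n - a‖ ≤ y0 := by
      intro n
      induction n with
      | zero => simp [b, hy00]
      | succ n ih =>
        rw [show b (n + 1) - a = (b (n + 1) - b n) + (b n - a) by ring]
        refine (IsUltrametricDist.norm_add_le_max _ _).trans (max_le ?_ ih)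
        exact (hdiff n).trans (mul_le_of_le_one_right hy00 (pow_le_one₀ hρ0 hρ1.le))
    exact (le_of_tendsto' (hζ.sub_const a).norm hba).trans_lt ha

theorem unity {A K : Type*} [CommRing A] [NormedField K] [CompleteSpace K] [IsUltrametricDist K]
    [Algebra A K] (O : Subalgebra A K) (hO : ∀ x, x ∈ O ↔ ‖x‖ ≤ 1) (M : Ideal O) (hM : M.IsMaximal)
    (q : ℕ) (hq : Nat.card (O ⧸ M) = q) (hq2 : 2 ≤ q) :
    ‖(q : K)‖ < 1 ∧ ∃ T : Finset K, T.card = q - 1 ∧ ∀ ζ ∈ T, ζ ^ (q - 1) = 1 := by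
  classical
  letI := Ideal.Quotient.field M
  haveI : Finite (O ⧸ M) := Nat.finite_of_card_ne_zero (by omega)
  letI : Fintype (O ⧸ M) := Fintype.ofFinite _
  have hcard : Fintype.card (O ⧸ M) = q := by rw [← hq, Nat.card_eq_fintype_card]
  have hMlt : ∀ x : O, x ∈ M → ‖(x : K)‖ < 1 := by
    intro x hx
    refine lt_of_le_of_ne ((hO _).1 x.2) fun h => ?_
    have hx0 : (x : K) ≠ 0 := by rw [← norm_pos_iff, h]; exact one_pos
    have hinv : (x : K)⁻¹ ∈ O := by rw [hO, norm_inv, h, inv_one]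
    apply hM.ne_top
    rw [Ideal.eq_top_iff_one]
    have : (⟨(x : K)⁻¹, hinv⟩ : O) * x = 1 := by
      ext; simp [hx0]
    rw [← this]
    exact M.mul_mem_left _ hx
  have hnM : ∀ x : O, x ∉ M → ‖(x : K)‖ = 1 := by
    intro x hx
    refine le_antisymm ((hO _).1 x.2) ?_
    obtain ⟨s, i, hi, hsi⟩ := hM.exists_inv hx
    have hi1 := hMlt i hi
    have hsi' : (s : K) * x + i = 1 := by exact_mod_cast congrArg (Subtype.val) hsi
    have h1 : ‖(s : K) * x‖ = 1 := by
      apply norm_eq_one_of_sub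
      rw [show (s : K) * x - 1 = -i by linear_combination hsi', norm_neg]
      exact hi1
    rw [← h1, norm_mul]
    exact mul_le_of_le_one_left (norm_nonneg _) ((hO _).1 s.2)
  have hqK : ‖(q : K)‖ < 1 := by
    have : ((q : ℕ) : O) ∈ M := by
      rw [← Ideal.Quotient.eq_zero_iff_mem, map_natCast, ← hcard]
      exact Nat.cast_card_eq_zero _
    simpa using hMlt _ this
  refine ⟨hqK, ?_⟩
  have hex : ∀ x : {x : O ⧸ M // x ≠ 0}, ∃ ζ : K, ζ ^ (q - 1) = 1 ∧
      ‖ζ - (Quotient.out x.1 : O)‖ < 1 := by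
    rintro ⟨x, hx⟩
    have hmk : Ideal.Quotient.mk M (Quotient.out x) = x := Quotient.out_eq x
    apply teich q hq2 hqK
    have : (Quotient.out x : O) ^ (q - 1) - 1 ∈ M := by
      rw [← Ideal.Quotient.eq_zero_iff_mem, map_sub, map_pow, hmk, map_one, ← hcard,
        FiniteField.pow_card_sub_one_eq_one x hx, sub_self]
    simpa using hMlt _ this
  choose f hf using hex
  have hinj : Function.Injective f := by
    rintro ⟨x, hx⟩ ⟨y, hy⟩ hxy
    by_contra hne
    have hmkx : Ideal.Quotient.mk M (Quotient.out x) = x := Quotient.out_eq x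
    have hmky : Ideal.Quotient.mk M (Quotient.out y) = y := Quotient.out_eq y
    have hnot : (Quotient.out x - Quotient.out y : O) ∉ M := by
      intro h
      rw [← Ideal.Quotient.eq_zero_iff_mem, map_sub, hmkx, hmky, sub_eq_zero] at h
      exact hne (Subtype.ext h)
    have h1 := hnM _ hnot
    have h2 := (hf ⟨x, hx⟩).2
    have h3 := (hf ⟨y, hy⟩).2
    rw [hxy] at h2
    have h4 : (((Quotient.out x - Quotient.out y : O)) : K) =
        (f ⟨y, hy⟩ - (Quotient.out y : O)) + -(f ⟨y, hy⟩ - (Quotient.out x : O)) := by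
      push_cast; ring
    rw [h4] at h1
    have h5 := IsUltrametricDist.norm_add_le_max (f ⟨y, hy⟩ - ((Quotient.out y : O) : K))
      (-(f ⟨y, hy⟩ - ((Quotient.out x : O) : K)))
    rw [norm_neg, h1] at h5
    exact absurd (h5.trans_lt (max_lt h3 h2)) (lt_irrefl _)
  refine ⟨Finset.univ.image f, ?_, ?_⟩
  · rw [Finset.card_image_of_injective _ hinj, Finset.card_univ, Fintype.card_subtype_compl,
      hcard, Fintype.card_subtype_eq]
  · intro ζ hζ
    obtain ⟨x, -, rfl⟩ := Finset.mem_image.1 hζ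
    exact (hf x).1

theorem unityK (K : Type*) [Field K] [Algebra ℚ_[p] K] [FiniteDimensional ℚ_[p] K]
    [Algebra ℤ_[p] K] [IsScalarTower ℤ_[p] ℚ_[p] K]
    (M : Ideal (integralClosure ℤ_[p] K)) (hM : M.IsMaximal)
    (q : ℕ) (hq : Nat.card ((integralClosure ℤ_[p] K) ⧸ M) = q) (hq2 : 2 ≤ q) :
    ‖((q : ℤ_[p]))‖ < 1 ∧ ∃ T : Finset K, T.card = q - 1 ∧ ∀ ζ ∈ T, ζ ^ (q - 1) = 1 := by
  letI : NormedField K := spectralNorm.normedField ℚ_[p] K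
  have hnorm : ∀ x : K, ‖x‖ = spectralNorm ℚ_[p] K x := fun x => rfl
  haveI : CompleteSpace K := spectralNorm.completeSpace ℚ_[p] K
  haveI : IsUltrametricDist K :=
    IsUltrametricDist.isUltrametricDist_of_isNonarchimedean_norm
      (isNonarchimedean_spectralNorm (K := ℚ_[p]) (L := K))
  have hO : ∀ x : K, x ∈ integralClosure ℤ_[p] K ↔ ‖x‖ ≤ 1 := by
    intro x
    have hxInt : IsIntegral ℚ_[p] x := Algebra.IsIntegral.isIntegral x
    have hmon := minpoly.monic hxInt
    rw [hnorm, spectralNorm, spectralValue_le_one_iff hmon, mem_integralClosure_iff]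
    constructor
    · intro h n
      rw [minpoly.isIntegrallyClosed_eq_field_fractions' ℚ_[p] h, coeff_map]
      exact PadicInt.norm_le_one _
    · intro h
      have hl : minpoly ℚ_[p] x ∈ lifts (algebraMap ℤ_[p] ℚ_[p]) := by
        rw [lifts_iff_coeff_lifts]
        intro n
        exact ⟨⟨_, h n⟩, rfl⟩
      obtain ⟨P, hP, -, hPm⟩ := lifts_and_natDegree_eq_and_monic hl hmon
      refine ⟨P, hPm, ?_⟩
      rw [IsScalarTower.algebraMap_eq ℤ_[p] ℚ_[p] K, ← eval₂_map, hP]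
      exact minpoly.aeval _ _
  obtain ⟨h1, h2⟩ := unity (integralClosure ℤ_[p] K) hO M hM q hq hq2
  refine ⟨?_, h2⟩
  have := spectralNorm_extends (K := ℚ_[p]) (L := K) (q : ℚ_[p])
  rw [map_natCast, ← hnorm] at this
  rw [this] at h1
  simpa using h1

theorem exists_root (q : ℕ) (hq2 : 2 ≤ q) (hq : ‖(q : ℤ_[p])‖ < 1) (u : ℤ_[p]) (hu : ‖u - 1‖ < 1) :
    ∃ v : ℤ_[p], v ≠ 0 ∧ v ^ (q - 1) = u := by
  have hd : ‖((q - 1 : ℕ) : ℤ_[p])‖ = 1 := by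
    have h := PadicInt.norm_add_eq_max_of_ne (q := (-1 : ℤ_[p])) (r := (q : ℤ_[p]))
      (by rw [norm_neg, norm_one]; exact hq.ne')
    rw [norm_neg, norm_one, max_eq_left hq.le] at h
    rw [Nat.cast_sub (by omega), ← h]
    congr 1
    push_cast; ring
  have h1 : (X ^ (q - 1) - C u : ℤ_[p][X]).eval 1 = -(u - 1) := by simp
  have h2 : (derivative (X ^ (q - 1) - C u : ℤ_[p][X])).eval 1 = ((q - 1 : ℕ) : ℤ_[p]) := by
    simp [derivative_X_pow]
  obtain ⟨v, hv, -⟩ := hensels_lemma (F := (X ^ (q - 1) - C u : ℤ_[p][X])) (a := (1 : ℤ_[p])) (by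
    simp only [coe_aeval_eq_eval]
    rw [h1, h2, hd, norm_neg]; simpa using hu)
  have hv' : v ^ (q - 1) = u := by
    simpa [coe_aeval_eq_eval, sub_eq_zero] using hv
  refine ⟨v, ?_, hv'⟩
  rintro rfl
  rw [zero_pow (by omega)] at hv'
  rw [← hv'] at hu
  simp at hu

theorem mainK (hodd : p ≠ 2) (K : Type*) [Field K] [Algebra ℚ_[p] K] [FiniteDimensional ℚ_[p] K]
    [Algebra ℤ_[p] K] [IsScalarTower ℤ_[p] ℚ_[p] K]
    (M : Ideal (integralClosure ℤ_[p] K)) (hM : M.IsMaximal)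
    (q : ℕ) (hq : Nat.card ((integralClosure ℤ_[p] K) ⧸ M) = q)
    (t : ℕ) (ht : 1 ≤ t) :
    ∃ g : Polynomial K, g ≠ 0 ∧ g.support.card ≤ t + 1 ∧ ∃ R : Finset K,
      R.card = (2 * t - 1) * (q - 1) ∧ ∀ x ∈ R, g.eval x = 0 ∧ x ≠ 0 := by
  classical
  by_cases hq2 : 2 ≤ q
  swap
  · refine ⟨1, one_ne_zero, ?_, ∅, ?_, by simp⟩
    · refine (Finset.card_le_card (support_C_subset (1 : K))).trans (by simp)
    · rw [show q - 1 = 0 by omega]; simp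
  obtain ⟨hqn, T, hT, hTu⟩ := unityK K M hM q hq hq2
  obtain ⟨h, c0, m, e, hc0, hm, he, hh, hcard, S, hS, hroots⟩ :=
    fewnomial hodd (q - 1) (by omega) (t - 1)
  have hinj : Function.Injective (algebraMap ℤ_[p] K) := by
    rw [IsScalarTower.algebraMap_eq ℤ_[p] ℚ_[p] K]
    exact (algebraMap ℚ_[p] K).injective.comp (IsFractionRing.injective ℤ_[p] ℚ_[p])
  have hp0 : (p : ℤ_[p]) ≠ 0 := by exact_mod_cast (Fact.out : p.Prime).ne_zero
  have hw : ∀ r, ∃ w : ℤ_[p], r ∈ S → w ≠ 0 ∧ w ^ (q - 1) = r := by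
    intro r
    by_cases hr : r ∈ S
    swap
    · exact ⟨0, fun h => absurd h hr⟩
    obtain ⟨-, -, l, u, hru, hu⟩ := hroots r hr
    obtain ⟨v, hv0, hv⟩ := exists_root q hq2 hqn u hu
    refine ⟨(p : ℤ_[p]) ^ l * v, fun _ => ⟨mul_ne_zero (pow_ne_zero _ hp0) hv0, ?_⟩⟩
    rw [hru, mul_pow, hv, ← pow_mul, mul_comm l]
  choose w hw using hw
  have hh0 : h ≠ 0 := by
    intro h0
    have := congrArg (eval 0) hh
    rw [h0] at this
    simp [hm.ne'] at this
    exact hc0 this.symm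
  have hq1 : 0 < q - 1 := by omega
  have hpow : ∀ r ∈ S, ∀ ζ ∈ T, (ζ * algebraMap ℤ_[p] K (w r)) ^ (q - 1) = algebraMap ℤ_[p] K r := by
    intro r hr ζ hζ
    rw [mul_pow, hTu ζ hζ, one_mul, ← map_pow, (hw r hr).2]
  have hwne : ∀ r ∈ S, algebraMap ℤ_[p] K (w r) ≠ 0 := by
    intro r hr h0
    exact (hw r hr).1 (hinj (h0.trans (map_zero _).symm))
  refine ⟨expand K (q - 1) (h.map (algebraMap ℤ_[p] K)), ?_, ?_,
    (S ×ˢ T).image (fun x => x.2 * algebraMap ℤ_[p] K (w x.1)), ?_, ?_⟩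
  · rw [Ne, expand_eq_zero hq1, Polynomial.map_eq_zero_iff hinj]
    exact hh0
  · have h1 : (expand K (q - 1) (h.map (algebraMap ℤ_[p] K))).support ⊆
        h.support.image (fun n => n * (q - 1)) := by
      intro n hn
      rw [mem_support_iff, coeff_expand hq1] at hn
      split_ifs at hn with hdvd
      · rw [Finset.mem_image]
        refine ⟨n / (q - 1), ?_, Nat.div_mul_cancel hdvd⟩
        rw [mem_support_iff]
        intro h0
        rw [coeff_map, h0, map_zero] at hn
        exact hn rfl
      · exact absurd rfl hn
    refine (Finset.card_le_card h1).trans (Finset.card_image_le.trans ?_)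
    omega
  · rw [Finset.card_image_of_injOn, Finset.card_product, hS, hT]
    · congr 1; omega
    · rintro ⟨r, ζ⟩ h1 ⟨r', ζ'⟩ h2 h12
      simp only [Finset.coe_product, Set.mem_prod, Finset.mem_coe] at h1 h2 h12
      have e1 := hpow r h1.1 ζ h1.2
      have e2 := hpow r' h2.1 ζ' h2.2
      rw [h12, e2] at e1
      have hrr : r' = r := hinj e1
      subst hrr
      have := mul_right_cancel₀ (hwne _ h1.1) h12
      rw [this]
  · intro x hx
    obtain ⟨⟨r, ζ⟩, hrz, rfl⟩ := Finset.mem_image.1 hx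
    rw [Finset.mem_product] at hrz
    refine ⟨?_, ?_⟩
    · rw [expand_eval, hpow r hrz.1 ζ hrz.2, eval_map_algebraMap, aeval_algebraMap_apply,
        coe_aeval_eq_eval, (hroots r hrz.1).1, map_zero]
    · refine mul_ne_zero ?_ (hwne _ hrz.1)
      intro h0
      have := hTu ζ hrz.2
      simp only at h0
      rw [h0, zero_pow hq1.ne'] at this
      exact zero_ne_one this
end

open scoped Classical

/-- Let `p` be an odd prime, `K/ℚ_p` a finite extension whose
residue field (quotient of the ring of integers, i.e. of the integral closure
of `ℤ_p` in `K`, by its maximal ideal) has cardinality `q`, and `t ≥ 1`.  Then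
there is a nonzero polynomial over `K` with at most `t+1` nonzero terms having
at least `(2t−1)(q−1)` distinct nonzero roots: `B₁(t,K) ≥ (2t−1)(q−1)`. -/
theorem B1_lower_bound (p : ℕ) [Fact p.Prime] (hodd : p ≠ 2)
    (K : Type*) [Field K] [Algebra ℚ_[p] K] [FiniteDimensional ℚ_[p] K]
    [Algebra ℤ_[p] K] [IsScalarTower ℤ_[p] ℚ_[p] K]
    (M : Ideal (integralClosure ℤ_[p] K)) (hM : M.IsMaximal)
    (q : ℕ) (hq : Nat.card ((integralClosure ℤ_[p] K) ⧸ M) = q)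
    (t : ℕ) (ht : 1 ≤ t) :
    ∃ g : Polynomial K, g ≠ 0 ∧ g.support.card ≤ t + 1 ∧
      (2 * t - 1) * (q - 1) ≤ (g.roots.toFinset.filter (fun r => r ≠ 0)).card := by
  obtain ⟨g, hg, hc, R, hR, hr⟩ := mainK hodd K M hM q hq t ht
  refine ⟨g, hg, hc, ?_⟩
  rw [← hR]
  apply Finset.card_le_card
  intro x hx
  rw [Finset.mem_filter, Multiset.mem_toFinset, Polynomial.mem_roots hg]
  exact hr x hx
end

section
/- Let p be a prime with p ≥ 5. Then: (i) every nonzero polynomial in ℚ_p[x] with at most 3 nonzero terms has at most 3(p−1) roots in ℚ_p \ {0} counted with multiplicities; and (ii) there exists a nonzero polynomial in ℚ_p[x] with at most 3 nonzero terms having at least 3(p−1) distinct roots in ℚ_p \ {0}. Consequently B₁(2,ℚ_p) = B_m(2,ℚ_p) = 3(p−1). -/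
open scoped Classical

open Polynomial in
/-- `N` bounds the Strassmann index of `g`. -/
def Dom {p : ℕ} [Fact p.Prime] (N : ℕ) (g : Polynomial ℚ_[p]) : Prop :=
  ∃ j ≤ N, (∀ k, ‖g.coeff k‖ ≤ ‖g.coeff j‖) ∧ ∀ k, N < k → ‖g.coeff k‖ < ‖g.coeff j‖

open Polynomial in
lemma exists_last_max {p : ℕ} [Fact p.Prime] (h : Polynomial ℚ_[p]) (h0 : h ≠ 0) :
    ∃ i, (∀ k, ‖h.coeff k‖ ≤ ‖h.coeff i‖) ∧ (∀ k, i < k → ‖h.coeff k‖ < ‖h.coeff i‖) := by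
  obtain ⟨i0, hi0, hmax⟩ := Finset.exists_max_image h.support (fun k => ‖h.coeff k‖)
    (Polynomial.support_nonempty.mpr h0)
  have hall : ∀ k, ‖h.coeff k‖ ≤ ‖h.coeff i0‖ := by
    intro k
    by_cases hk : k ∈ h.support
    · exact hmax k hk
    · rw [Polynomial.notMem_support_iff.mp hk]; simp
  have hpos : 0 < ‖h.coeff i0‖ := by simpa using hi0
  let S := h.support.filter (fun k => ‖h.coeff k‖ = ‖h.coeff i0‖)
  have hS : S.Nonempty := ⟨i0, by exact Finset.mem_filter.mpr ⟨hi0, rfl⟩⟩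
  have hm := Finset.max'_mem S hS
  have hm2 : ‖h.coeff (S.max' hS)‖ = ‖h.coeff i0‖ := by
    have := hm
    simp only [S, Finset.mem_filter] at this
    exact this.2
  refine ⟨S.max' hS, ?_, ?_⟩
  · rw [hm2]; exact hall
  · intro k hk
    rw [hm2]
    refine lt_of_le_of_ne (hall k) ?_
    intro he
    have : k ∈ S := by
      simp only [S, Finset.mem_filter]
      refine ⟨?_, he⟩
      rw [Polynomial.mem_support_iff]
      intro h0
      rw [h0] at he
      simp at he
      rw [← he] at hpos
      simp at hpos
    exact absurd (Finset.le_max' S k this) (not_le.mpr hk)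

open Polynomial in
lemma dom_step {p : ℕ} [Fact p.Prime] (h : Polynomial ℚ_[p]) (y : ℚ_[p]) (hy : ‖y‖ ≤ 1) (N : ℕ)
    (hd : Dom N ((X - C y) * h)) : ∃ N', N = N' + 1 ∧ Dom N' h := by
  obtain ⟨j, hjN, hj1, hj2⟩ := hd
  have h0 : h ≠ 0 := by
    rintro rfl
    have := hj2 (N+1) (by omega)
    simp at this
  obtain ⟨i, hi1, hi2⟩ := exists_last_max h h0
  have c0 : ((X - C y) * h).coeff 0 = - (y * h.coeff 0) := by
    simp [sub_mul]
  have cs : ∀ k, ((X - C y) * h).coeff (k+1) = h.coeff k - y * h.coeff (k+1) := by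
    intro k
    simp [sub_mul]
  have hyl : ∀ k, ‖y * h.coeff k‖ ≤ ‖h.coeff k‖ := by
    intro k
    rw [norm_mul]
    nlinarith [norm_nonneg (h.coeff k)]
  have hle : ∀ k, ‖((X - C y) * h).coeff k‖ ≤ ‖h.coeff i‖ := by
    intro k
    cases k with
    | zero => rw [c0, norm_neg]; exact (hyl 0).trans (hi1 0)
    | succ k =>
      rw [cs, sub_eq_add_neg]
      refine (Padic.nonarchimedean _ _).trans (max_le (hi1 k) ?_)
      rw [norm_neg]; exact (hyl _).trans (hi1 _)
  have heq : ‖((X - C y) * h).coeff (i+1)‖ = ‖h.coeff i‖ := by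
    have h1 : ‖-(y * h.coeff (i+1))‖ < ‖h.coeff i‖ := by
      rw [norm_neg]; exact (hyl _).trans_lt (hi2 _ (by omega))
    rw [cs, sub_eq_add_neg, IsUltrametricDist.norm_add_eq_max_of_norm_ne_norm h1.ne',
      max_eq_left h1.le]
  have hiN : i + 1 ≤ N := by
    by_contra hc
    have := hj2 (i+1) (by omega)
    rw [heq] at this
    exact absurd (hle j) (not_le.mpr this)
  refine ⟨N - 1, by omega, i, by omega, hi1, fun k hk => hi2 k (by omega)⟩

open Polynomial in
lemma dom_card {p : ℕ} [Fact p.Prime] (t : Multiset ℚ_[p]) : ∀ (g : Polynomial ℚ_[p]) (N : ℕ),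
    (∀ y ∈ t, ‖y‖ ≤ 1) → (t.map (fun y => X - C y)).prod ∣ g → Dom N g → t.card ≤ N := by
  induction t using Multiset.induction with
  | empty => intros; simp
  | cons y t ih =>
    intro g N hy hdiv hd
    rw [Multiset.map_cons, Multiset.prod_cons] at hdiv
    obtain ⟨q, rfl⟩ := hdiv
    rw [mul_assoc] at hd
    obtain ⟨N', rfl, hd'⟩ := dom_step _ y (hy y (by simp)) N hd
    rw [Multiset.card_cons]
    have := ih _ N' (fun z hz => hy z (by simp [hz])) (Dvd.intro _ rfl) hd'
    omega

open Polynomial in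
lemma class_count {p : ℕ} [Fact p.Prime] (f : Polynomial ℚ_[p]) (_hf : f ≠ 0) (r : ℚ_[p])
    (hr : r ≠ 0) (N : ℕ) (hd : Dom N (f.comp (C (r * p) * X + C r))) :
    (f.roots.filter (fun x => ‖x - r‖ < ‖r‖)).card ≤ N := by
  have hp0 : (p : ℚ_[p]) ≠ 0 := by exact_mod_cast (Fact.out : p.Prime).ne_zero
  set s := f.roots.filter (fun x => ‖x - r‖ < ‖r‖) with hs
  set t := s.map (fun x => (r * p)⁻¹ * (x - r)) with ht
  have hcard : t.card = s.card := by simp [ht]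
  rw [← hcard]
  have hg0 : f.comp (C (r * p) * X + C r) ≠ 0 := by
    intro h
    obtain ⟨j, -, -, hj2⟩ := hd
    have := hj2 (N+1) (by omega)
    rw [h] at this; simp at this
  refine dom_card t _ N ?_ ?_ hd
  · intro y hy
    obtain ⟨x, hx, rfl⟩ := Multiset.mem_map.mp hy
    have hx2 := (Multiset.mem_filter.mp hx).2
    have h1 : ‖(x - r) / r‖ < 1 := by
      rw [norm_div]; exact (div_lt_one (norm_pos_iff.mpr hr)).mpr hx2
    obtain ⟨z, hz⟩ : ∃ z : ℤ_[p], (z : ℚ_[p]) = (x-r)/r := ⟨⟨(x-r)/r, h1.le⟩, rfl⟩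
    have h2 : ‖z‖ < 1 := by rw [PadicInt.norm_def, hz]; exact h1
    rw [PadicInt.norm_lt_one_iff_dvd] at h2
    obtain ⟨w, hw⟩ := h2
    have hw' : (x - r) / r = p * (w : ℚ_[p]) := by
      have := congrArg (fun z : ℤ_[p] => (z : ℚ_[p])) hw
      rw [← hz]
      simpa using this
    have : (r * (p:ℚ_[p]))⁻¹ * (x - r) = w := by
      field_simp at hw' ⊢
      rw [hw']
    rw [this]
    exact w.2
  · rw [Multiset.prod_X_sub_C_dvd_iff_le_roots hg0,
      Polynomial.roots_comp_C_mul_X_add_C _ _ _ (isUnit_iff_ne_zero.mpr (mul_ne_zero hr hp0)), ht,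
      Ring.inverse_eq_inv']
    exact Multiset.map_le_map (Multiset.filter_le _ _)

lemma card_le_fiber {α β : Type*} [DecidableEq β] (s : Multiset α) (g : α → β) (T : Finset β)
    (hT : ∀ x ∈ s, g x ∈ T) (N : ℕ) (hN : ∀ b ∈ T, (s.filter (fun x => g x = b)).card ≤ N) :
    s.card ≤ T.card * N := by
  have h1 : s.card = ∑ b ∈ T, (s.filter (fun x => g x = b)).card := by
    have := Multiset.sum_count_eq_card (s := T) (m := s.map g) (by simpa using hT)
    rw [Multiset.card_map] at this
    rw [← this]
    refine Finset.sum_congr rfl fun b _ => ?_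
    rw [Multiset.count_map]
    simp only [eq_comm]
  rw [h1]
  simpa using Finset.sum_le_card_nsmul T _ N hN

lemma sphere_count {p : ℕ} [Fact p.Prime] (s : Multiset ℚ_[p]) (N : ℕ) (ρ : ℝ) (hρ : 0 < ρ)
    (hs : ∀ r ∈ s, ‖r‖ = ρ) (hN : ∀ r ∈ s, (s.filter (fun x => ‖x - r‖ < ‖r‖)).card ≤ N) :
    s.card ≤ (p - 1) * N := by
  rcases Multiset.empty_or_exists_mem s with rfl | ⟨r1, hr1⟩
  · simp
  have hr1n := hs r1 hr1
  let toInt : ℚ_[p] → ℤ_[p] := fun x => if h : ‖x‖ ≤ 1 then ⟨x, h⟩ else 0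
  have htoInt : ∀ x, ‖x‖ ≤ 1 → ((toInt x : ℤ_[p]) : ℚ_[p]) = x := by
    intro x hx; simp [toInt, hx]
  have hn1 : ∀ r ∈ s, ‖r / r1‖ = 1 := by
    intro r hr
    rw [norm_div, hs r hr, hr1n, div_self hρ.ne']
  have key : ∀ r ∈ s, ∀ r' ∈ s, PadicInt.toZMod (toInt (r / r1)) = PadicInt.toZMod (toInt (r' / r1)) →
      ‖r - r'‖ < ρ := by
    intro r hr r' hr' h
    have : toInt (r/r1) - toInt (r'/r1) ∈ RingHom.ker (PadicInt.toZMod (p := p)) := by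
      rw [RingHom.mem_ker, map_sub, h, sub_self]
    rw [PadicInt.ker_toZMod, IsLocalRing.mem_maximalIdeal, PadicInt.mem_nonunits,
      PadicInt.norm_def, PadicInt.coe_sub, htoInt _ (hn1 r hr).le, htoInt _ (hn1 r' hr').le,
      ← sub_div, norm_div, hr1n, div_lt_one hρ] at this
    exact this
  have hT : (Finset.univ.erase (0 : ZMod p)).card = p - 1 := by
    rw [Finset.card_erase_of_mem (Finset.mem_univ _), Finset.card_univ, ZMod.card]
  rw [← hT]
  refine card_le_fiber s (fun r => PadicInt.toZMod (toInt (r / r1))) _ ?_ N ?_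
  · intro r hr
    rw [Finset.mem_erase]
    refine ⟨?_, Finset.mem_univ _⟩
    intro h
    have : toInt (r/r1) ∈ RingHom.ker (PadicInt.toZMod (p := p)) := h
    rw [PadicInt.ker_toZMod, IsLocalRing.mem_maximalIdeal, PadicInt.mem_nonunits,
      PadicInt.norm_def, htoInt _ (hn1 r hr).le, hn1 r hr] at this
    exact lt_irrefl _ this
  · intro b _
    rcases Multiset.empty_or_exists_mem (s.filter (fun r => PadicInt.toZMod (toInt (r / r1)) = b)) with h | ⟨r, hr⟩
    · rw [h]; simp
    · obtain ⟨hrs, hrb⟩ := Multiset.mem_filter.mp hr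
      refine le_trans (Multiset.card_le_card ?_) (hN r hrs)
      rw [Multiset.le_filter]
      refine ⟨Multiset.filter_le _ _, ?_⟩
      intro x hx
      obtain ⟨hxs, hxb⟩ := Multiset.mem_filter.mp hx
      rw [hs r hrs]
      exact key x hxs r hrs (hxb.trans hrb.symm)

lemma fact_bound {p : ℕ} [Fact p.Prime] (hp : 5 ≤ p) (k : ℕ) (hk : 3 ≤ k) (B : ℚ_[p]) :
    ‖(p : ℚ_[p]) ^ k * B‖ ≤ ‖(p : ℚ_[p])‖ ^ 3 * ‖(k.factorial : ℚ_[p]) * B‖ := by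
  have hP : p.Prime := Fact.out
  have hv := sub_one_mul_padicValNat_factorial_lt_of_ne_zero (p := p) (n := k) (by omega)
  set v := padicValNat p k.factorial with hvdef
  have h4 : 4 * v ≤ (p - 1) * v := Nat.mul_le_mul_right _ (by omega)
  have hvk : v + 3 ≤ k := by omega
  have hnorm : ‖(k.factorial : ℚ_[p])‖ = ‖(p : ℚ_[p])‖ ^ v := by
    obtain ⟨u, hu⟩ : p ^ v ∣ k.factorial := pow_padicValNat_dvd
    have hpu : ¬ p ∣ u := by
      rintro ⟨w, rfl⟩
      have : p ^ (v + 1) ∣ k.factorial := ⟨w, by rw [hu]; ring⟩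
      exact pow_succ_padicValNat_not_dvd (Nat.factorial_ne_zero k) this
    have hu1 : ‖(u : ℚ_[p])‖ = 1 := by
      rw [Padic.norm_natCast_eq_one_iff]; exact (Nat.Prime.coprime_iff_not_dvd hP).mpr hpu
    rw [hu]; push_cast; rw [norm_mul, norm_pow, hu1, mul_one]
  rw [norm_mul, norm_mul, norm_pow, hnorm, ← mul_assoc, ← pow_add]
  refine mul_le_mul_of_nonneg_right ?_ (norm_nonneg _)
  exact pow_le_pow_of_le_one (norm_nonneg _) Padic.norm_p_lt_one.le (by omega)

open Polynomial in
lemma desc_lin (m n k : ℕ) : ∃ α β : ℤ,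
    ((m.descFactorial (k+1) : ℕ) : ℤ) = α * m + β * (m * (m - 1)) ∧
    ((n.descFactorial (k+1) : ℕ) : ℤ) = α * n + β * (n * (n - 1)) := by
  set Q : ℤ[X] := (descPochhammer ℤ k).comp (X - 1)
  have h : ∀ a : ℕ, ((a.descFactorial (k+1) : ℕ) : ℤ) = a * Q.eval (a : ℤ) := by
    intro a
    rw [← descPochhammer_eval_eq_descFactorial, descPochhammer_succ_left, eval_mul, eval_X]
  obtain ⟨β, hβ⟩ := Polynomial.sub_dvd_eval_sub (n : ℤ) (m : ℤ) Q
  refine ⟨Q.eval (m : ℤ) - β * (m - 1), β, ?_, ?_⟩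
  · rw [h]; ring
  · rw [h]
    have : Q.eval (n:ℤ) = Q.eval (m : ℤ) + (n - m) * β := by rw [← hβ]; ring
    rw [this]; ring

open Polynomial in
/-- A trinomial with constant term. -/
noncomputable def tri {p : ℕ} [Fact p.Prime] (a b c : ℚ_[p]) (m n : ℕ) : Polynomial ℚ_[p] :=
  C a + C b * X ^ m + C c * X ^ n

open Polynomial in
lemma tri_comp_coeff {p : ℕ} [Fact p.Prime] (a b c r : ℚ_[p]) (m n k : ℕ) :
    ((tri a b c m n).comp (C (r * p) * X + C r)).coeff (k + 1) =
      (p : ℚ_[p]) ^ (k + 1) * (b * r ^ m * (m.choose (k + 1)) + c * r ^ n * (n.choose (k + 1))) := by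
  have h : ∀ m : ℕ, (C (r * (p : ℚ_[p])) * X + C r) ^ m =
      C (r ^ m) * ((1 + X) ^ m : Polynomial ℚ_[p]).comp (C (p : ℚ_[p]) * X) := by
    intro m
    rw [pow_comp, C_pow, ← mul_pow]
    congr 1
    simp only [add_comp, one_comp, X_comp, C_mul]
    ring
  simp only [tri, add_comp, mul_comp, C_comp, X_pow_comp]
  rw [h m, h n]
  simp only [coeff_add, coeff_C_mul, comp_C_mul_X_coeff, coeff_one_add_X_pow, coeff_C_succ]
  ring

open Polynomial in
lemma tri_comp_coeff_zero {p : ℕ} [Fact p.Prime] (f : Polynomial ℚ_[p]) (r : ℚ_[p])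
    (hr : f.eval r = 0) : (f.comp (C (r * p) * X + C r)).coeff 0 = 0 := by
  rw [coeff_zero_eq_eval_zero, eval_comp]
  simpa using hr

lemma A_bound {p : ℕ} [Fact p.Prime] (hp : 5 ≤ p) (b c : ℚ_[p]) (m n k : ℕ) (hk : 3 ≤ k) (M : ℝ)
    (h1 : ‖b * m + c * n‖ ≤ M) (h2 : ‖b * (m * (m - 1)) + c * (n * (n - 1))‖ ≤ M) :
    ‖(p : ℚ_[p]) ^ k * (b * (m.choose k) + c * (n.choose k))‖ ≤ ‖(p : ℚ_[p])‖ ^ 3 * M := by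
  refine (fact_bound hp k hk _).trans ?_
  refine mul_le_mul_of_nonneg_left ?_ (by positivity)
  obtain ⟨k, rfl⟩ : ∃ j, k = j + 1 := ⟨k - 1, by omega⟩
  obtain ⟨α, β, hm, hn⟩ := desc_lin m n k
  have hm' := congrArg (fun z : ℤ => (z : ℚ_[p])) hm
  have hn' := congrArg (fun z : ℤ => (z : ℚ_[p])) hn
  rw [Nat.descFactorial_eq_factorial_mul_choose] at hm' hn'
  push_cast at hm' hn'
  have : ((k+1).factorial : ℚ_[p]) * (b * (m.choose (k+1)) + c * (n.choose (k+1))) =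
      α * (b * m + c * n) + β * (b * (m * (m - 1)) + c * (n * (n - 1))) := by
    linear_combination b * hm' + c * hn'
  rw [this]
  refine (Padic.nonarchimedean _ _).trans (max_le ?_ ?_)
  · rw [norm_mul]
    exact (mul_le_of_le_one_left (norm_nonneg _) (Padic.norm_int_le_one α)).trans h1
  · rw [norm_mul]
    exact (mul_le_of_le_one_left (norm_nonneg _) (Padic.norm_int_le_one β)).trans h2

lemma coeff_two_norm {p : ℕ} [Fact p.Prime] (hp : 5 ≤ p) (b c : ℚ_[p]) (m n : ℕ) :
    ‖(p : ℚ_[p]) ^ 2 * (b * (m.choose 2) + c * (n.choose 2))‖ =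
      ‖(p : ℚ_[p])‖ ^ 2 * ‖b * (m * (m - 1)) + c * (n * (n - 1))‖ := by
  have h2 : ‖(2 : ℚ_[p])‖ = 1 := by
    have : ‖((2 : ℕ) : ℚ_[p])‖ = 1 := by
      rw [Padic.norm_natCast_eq_one_iff]
      refine (Nat.Prime.coprime_iff_not_dvd Fact.out).mpr ?_
      intro h
      have := Nat.le_of_dvd (by norm_num) h
      omega
    exact_mod_cast this
  have : b * (m * (m - 1)) + c * (n * (n - 1)) = 2 * (b * (m.choose 2) + c * (n.choose 2)) := by
    rw [Nat.cast_choose_two, Nat.cast_choose_two]; ring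
  rw [this, norm_mul 2, h2, one_mul, norm_mul, norm_pow]

section

variable {p : ℕ} [Fact p.Prime]

open Polynomial in
lemma tri_dom_two (hp : 5 ≤ p) (a b c r : ℚ_[p]) (m n : ℕ) (hm : 0 < m) (hmn : m < n)
    (hbc : b ≠ 0 ∨ c ≠ 0) (hr0 : r ≠ 0) (hr : (tri a b c m n).eval r = 0) :
    Dom 2 ((tri a b c m n).comp (C (r * p) * X + C r)) := by
  set g := (tri a b c m n).comp (C (r * p) * X + C r) with hg
  have c0 : g.coeff 0 = 0 := tri_comp_coeff_zero _ _ hr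
  have cs := tri_comp_coeff a b c r m n
  rw [← hg] at cs
  have hbc' : b * r ^ m ≠ 0 ∨ c * r ^ n ≠ 0 := by
    rcases hbc with h | h
    · left; exact mul_ne_zero h (pow_ne_zero _ hr0)
    · right; exact mul_ne_zero h (pow_ne_zero _ hr0)
  generalize b * r ^ m = b' at *
  generalize c * r ^ n = c' at *
  set A1 := b' * m + c' * n with hA1
  set A2 := b' * (m * (m - 1)) + c' * (n * (n - 1)) with hA2
  have n1 : ‖g.coeff 1‖ = ‖(p : ℚ_[p])‖ * ‖A1‖ := by
    rw [cs 0]; simp [hA1]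
  have n2 : ‖g.coeff 2‖ = ‖(p : ℚ_[p])‖ ^ 2 * ‖A2‖ := by
    rw [cs 1]; exact coeff_two_norm hp b' c' m n
  have n3 : ∀ k, 3 ≤ k → ‖g.coeff k‖ ≤ ‖(p : ℚ_[p])‖ ^ 3 * max ‖A1‖ ‖A2‖ := by
    intro k hk
    obtain ⟨j, rfl⟩ : ∃ j, k = j + 1 := ⟨k - 1, by omega⟩
    rw [cs j]
    exact A_bound hp b' c' m n (j+1) hk _ (le_max_left _ _) (le_max_right _ _)
  have hA : A1 ≠ 0 ∨ A2 ≠ 0 := by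
    by_contra hcon
    push Not at hcon
    obtain ⟨e1, e2⟩ := hcon
    have hm0 : (m : ℚ_[p]) ≠ 0 := by exact_mod_cast hm.ne'
    have hn0 : (n : ℚ_[p]) ≠ 0 := by exact_mod_cast (by omega : n ≠ 0)
    have hmn0 : (n : ℚ_[p]) - m ≠ 0 := by
      rw [sub_ne_zero]; exact_mod_cast hmn.ne'
    have hc : c' = 0 := by
      have : c' * (n * (n - m)) = 0 := by
        rw [hA1] at e1; rw [hA2] at e2
        linear_combination e2 - (m - 1) * e1
      simpa [hn0, hmn0] using this
    have hb : b' = 0 := by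
      rw [hA1, hc] at e1
      simpa [hm0] using e1
    rcases hbc' with h | h
    · exact h hb
    · exact h hc
  have hp0 : 0 < ‖(p : ℚ_[p])‖ := by
    rw [norm_pos_iff]; exact_mod_cast (Fact.out : p.Prime).ne_zero
  have hp1 : ‖(p : ℚ_[p])‖ < 1 := Padic.norm_p_lt_one
  generalize ‖(p : ℚ_[p])‖ = q at *
  have hM : ∀ M, ‖g.coeff 1‖ ≤ M → ‖g.coeff 2‖ ≤ M → 0 < M ∧ ∀ k, 3 ≤ k → ‖g.coeff k‖ < M := by
    intro M h1 h2
    rw [n1] at h1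
    rw [n2] at h2
    have hMpos : 0 < M := by
      rcases hA with h | h
      · have := norm_pos_iff.mpr h
        refine lt_of_lt_of_le (by positivity) h1
      · have := norm_pos_iff.mpr h
        refine lt_of_lt_of_le (by positivity) h2
    refine ⟨hMpos, fun k hk => lt_of_le_of_lt (n3 k hk) ?_⟩
    have hqM : q * M < M := by nlinarith
    have hq2 : q ^ 2 ≤ q := by nlinarith
    rcases max_choice ‖A1‖ ‖A2‖ with h | h <;> rw [h]
    · calc q ^ 3 * ‖A1‖ = q ^ 2 * (q * ‖A1‖) := by ring
        _ ≤ q * M := mul_le_mul hq2 h1 (by positivity) hp0.le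
        _ < M := hqM
    · calc q ^ 3 * ‖A2‖ = q * (q ^ 2 * ‖A2‖) := by ring
        _ ≤ q * M := mul_le_mul_of_nonneg_left h2 hp0.le
        _ < M := hqM
  rcases le_total ‖g.coeff 1‖ ‖g.coeff 2‖ with h | h
  · obtain ⟨hpos, hk⟩ := hM _ h le_rfl
    refine ⟨2, le_rfl, ?_, fun k hk' => hk k hk'⟩
    intro k
    rcases k with _ | _ | _ | k
    · rw [c0, norm_zero]; exact hpos.le
    · exact h
    · exact le_rfl
    · exact (hk _ (by omega)).le
  · obtain ⟨hpos, hk⟩ := hM _ le_rfl h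
    refine ⟨1, by omega, ?_, fun k hk' => hk k hk'⟩
    intro k
    rcases k with _ | _ | _ | k
    · rw [c0, norm_zero]; exact hpos.le
    · exact le_rfl
    · exact h
    · exact (hk _ (by omega)).le

open Polynomial in
lemma tri_dom_one (hp : 5 ≤ p) (a b c r : ℚ_[p]) (m n : ℕ)
    (hr : (tri a b c m n).eval r = 0)
    (h0 : b * r ^ m * m + c * r ^ n * n ≠ 0)
    (hle : ‖b * r ^ m * (m * (m - 1)) + c * r ^ n * (n * (n - 1))‖ ≤ ‖b * r ^ m * m + c * r ^ n * n‖) :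
    Dom 1 ((tri a b c m n).comp (C (r * p) * X + C r)) := by
  set g := (tri a b c m n).comp (C (r * p) * X + C r) with hg
  have c0 : g.coeff 0 = 0 := tri_comp_coeff_zero _ _ hr
  have cs := tri_comp_coeff a b c r m n
  rw [← hg] at cs
  generalize b * r ^ m = b' at *
  generalize c * r ^ n = c' at *
  have n1 : ‖g.coeff 1‖ = ‖(p : ℚ_[p])‖ * ‖b' * m + c' * n‖ := by
    rw [cs 0]; simp
  have n2 : ‖g.coeff 2‖ ≤ ‖(p : ℚ_[p])‖ ^ 2 * ‖b' * m + c' * n‖ := by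
    rw [cs 1]; refine (coeff_two_norm hp b' c' m n).trans_le ?_
    exact mul_le_mul_of_nonneg_left hle (by positivity)
  have n3 : ∀ k, 3 ≤ k → ‖g.coeff k‖ ≤ ‖(p : ℚ_[p])‖ ^ 3 * ‖b' * m + c' * n‖ := by
    intro k hk
    obtain ⟨j, rfl⟩ : ∃ j, k = j + 1 := ⟨k - 1, by omega⟩
    rw [cs j]
    exact A_bound hp b' c' m n (j+1) hk _ le_rfl hle
  have hp0 : 0 < ‖(p : ℚ_[p])‖ := by
    rw [norm_pos_iff]; exact_mod_cast (Fact.out : p.Prime).ne_zero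
  have hp1 : ‖(p : ℚ_[p])‖ < 1 := Padic.norm_p_lt_one
  have hApos := norm_pos_iff.mpr h0
  generalize ‖(p : ℚ_[p])‖ = q at *
  generalize ‖b' * m + c' * n‖ = A at *
  have hk : ∀ k, 1 < k → ‖g.coeff k‖ < ‖g.coeff 1‖ := by
    intro k hk
    rw [n1]
    have hq2 : q ^ 2 < q := by nlinarith
    have hq3 : q ^ 3 < q := by nlinarith
    rcases Nat.lt_or_ge k 3 with h | h
    · obtain rfl : k = 2 := by omega
      exact n2.trans_lt (mul_lt_mul_of_pos_right hq2 hApos)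
    · exact (n3 k h).trans_lt (mul_lt_mul_of_pos_right hq3 hApos)
  refine ⟨1, le_rfl, ?_, hk⟩
  intro k
  rcases k with _ | _ | k
  · rw [c0]; simp
  · exact le_rfl
  · exact (hk _ (by omega)).le

end

section

variable {p : ℕ} [Fact p.Prime]

lemma ultra_three (x y z : ℚ_[p]) (h : x + y + z = 0) :
    (‖x‖ = ‖y‖ ∧ ‖z‖ < ‖y‖) ∨ (‖y‖ = ‖z‖ ∧ ‖x‖ < ‖z‖) ∨ (‖x‖ = ‖z‖ ∧ ‖y‖ ≤ ‖z‖) := by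
  have hx : ‖x‖ ≤ max ‖y‖ ‖z‖ := by
    have : x = -(y + z) := by linear_combination h
    rw [this, norm_neg]; exact Padic.nonarchimedean _ _
  have hy : ‖y‖ ≤ max ‖x‖ ‖z‖ := by
    have : y = -(x + z) := by linear_combination h
    rw [this, norm_neg]; exact Padic.nonarchimedean _ _
  have hz : ‖z‖ ≤ max ‖x‖ ‖y‖ := by
    have : z = -(x + y) := by linear_combination h
    rw [this, norm_neg]; exact Padic.nonarchimedean _ _
  rw [le_max_iff] at hx hy hz
  grind

lemma ultra_comb (x y : ℚ_[p]) (hxy : ‖y‖ < ‖x‖) (s t : ℤ) :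
    x + y ≠ 0 ∧ ‖x * s + y * t‖ ≤ ‖x + y‖ := by
  have h : ‖x + y‖ = ‖x‖ := by
    rw [IsUltrametricDist.norm_add_eq_max_of_norm_ne_norm hxy.ne', max_eq_left hxy.le]
  constructor
  · intro h0
    rw [h0, norm_zero] at h
    rw [← h] at hxy
    exact absurd (norm_nonneg y) (not_le.mpr hxy)
  · rw [h]
    refine (Padic.nonarchimedean _ _).trans (max_le ?_ ?_)
    · rw [norm_mul]
      exact mul_le_of_le_one_right (norm_nonneg _) (Padic.norm_int_le_one s)
    · rw [norm_mul]
      exact (mul_le_of_le_one_right (norm_nonneg _) (Padic.norm_int_le_one t)).trans hxy.le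

lemma eval_tri (a b c r : ℚ_[p]) (m n : ℕ) :
    (tri a b c m n).eval r = a + b * r ^ m + c * r ^ n := by
  simp [tri]

lemma tri_ne_zero (a b c : ℚ_[p]) (m n : ℕ) (hm : 0 < m) (hmn : m < n)
    (hbc : b ≠ 0 ∨ c ≠ 0) : tri a b c m n ≠ 0 := by
  intro h
  rcases hbc with hb | hc
  · have := congrArg (fun f => Polynomial.coeff f m) h
    simp [tri, Polynomial.coeff_C, Polynomial.coeff_X_pow, hm.ne', hmn.ne] at this
    exact hb this
  · have := congrArg (fun f => Polynomial.coeff f n) h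
    simp [tri, Polynomial.coeff_C, Polynomial.coeff_X_pow, (hm.trans hmn).ne', hmn.ne'] at this
    exact hc this

lemma count_two (hp : 5 ≤ p) (a b c r : ℚ_[p]) (m n : ℕ) (hm : 0 < m) (hmn : m < n)
    (hbc : b ≠ 0 ∨ c ≠ 0) (hr0 : r ≠ 0) (hr : (tri a b c m n).eval r = 0) :
    ((tri a b c m n).roots.filter (fun x => ‖x - r‖ < ‖r‖)).card ≤ 2 :=
  class_count _ (tri_ne_zero a b c m n hm hmn hbc) r hr0 2
    (tri_dom_two hp a b c r m n hm hmn hbc hr0 hr)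

lemma count_left (hp : 5 ≤ p) (a b c r : ℚ_[p]) (m n : ℕ) (hm : 0 < m) (hmn : m < n)
    (hbc : b ≠ 0 ∨ c ≠ 0) (hr0 : r ≠ 0) (hr : (tri a b c m n).eval r = 0)
    (h1 : ‖c * r ^ n‖ < ‖b * r ^ m‖) (h2 : ‖(n : ℚ_[p])‖ ≤ ‖(m : ℚ_[p])‖) :
    ((tri a b c m n).roots.filter (fun x => ‖x - r‖ < ‖r‖)).card ≤ 1 := by
  have hm0 : 0 < ‖(m : ℚ_[p])‖ := by
    rw [norm_pos_iff]; exact_mod_cast hm.ne'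
  have hlt : ‖c * r ^ n * n‖ < ‖b * r ^ m * m‖ := by
    rw [norm_mul _ (n : ℚ_[p]), norm_mul _ (m : ℚ_[p])]
    exact lt_of_le_of_lt (mul_le_mul_of_nonneg_left h2 (norm_nonneg _))
      (mul_lt_mul_of_pos_right h1 hm0)
  obtain ⟨h3, h4⟩ := ultra_comb _ _ hlt ((m : ℤ) - 1) ((n : ℤ) - 1)
  refine class_count _ (tri_ne_zero a b c m n hm hmn hbc) r hr0 1
    (tri_dom_one hp a b c r m n hr h3 (le_of_eq_of_le ?_ h4))
  congr 1
  push_cast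
  ring

lemma count_right (hp : 5 ≤ p) (a b c r : ℚ_[p]) (m n : ℕ) (hm : 0 < m) (hmn : m < n)
    (hbc : b ≠ 0 ∨ c ≠ 0) (hr0 : r ≠ 0) (hr : (tri a b c m n).eval r = 0)
    (h1 : ‖a‖ < ‖c * r ^ n‖) (h2 : ‖(m : ℚ_[p])‖ ≤ ‖(n : ℚ_[p]) - m‖) :
    ((tri a b c m n).roots.filter (fun x => ‖x - r‖ < ‖r‖)).card ≤ 1 := by
  have hm0 : 0 < ‖(n : ℚ_[p]) - m‖ := by
    rw [norm_pos_iff, sub_ne_zero]; exact_mod_cast hmn.ne'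
  have hlt : ‖-a * m‖ < ‖c * r ^ n * (n - m)‖ := by
    rw [norm_mul _ ((n : ℚ_[p]) - m), norm_mul _ (m : ℚ_[p]), norm_neg]
    exact lt_of_le_of_lt (mul_le_mul_of_nonneg_left h2 (norm_nonneg _))
      (mul_lt_mul_of_pos_right h1 hm0)
  obtain ⟨h3, h4⟩ := ultra_comb _ _ hlt ((m : ℤ) + n - 1) ((m : ℤ) - 1)
  rw [eval_tri] at hr
  have e1 : c * r ^ n * (n - m) + -a * m = b * r ^ m * m + c * r ^ n * n := by
    linear_combination (-(m : ℚ_[p])) * hr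
  have e2 : b * r ^ m * (m * (m - 1)) + c * r ^ n * (n * (n - 1)) =
      c * r ^ n * (n - m) * ((m + n - 1 : ℤ) : ℚ_[p]) + -a * m * ((m - 1 : ℤ) : ℚ_[p]) := by
    push_cast
    linear_combination ((m : ℚ_[p]) * (m - 1)) * hr
  rw [e1] at h3 h4
  refine class_count _ (tri_ne_zero a b c m n hm hmn hbc) r hr0 1
    (tri_dom_one hp a b c r m n (by rw [eval_tri]; exact hr) h3 (le_of_eq_of_le ?_ h4))
  rw [e2]

lemma real_t3 (A B C x x0 : ℝ) (m n : ℕ) (hm : 0 < m) (hmn : m < n) (hB : 0 ≤ B)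
    (hC : 0 < C) (hx : 0 < x) (hx0 : 0 < x0)
    (h1 : A = C * x0 ^ n) (h2 : B * x0 ^ m ≤ C * x0 ^ n)
    (h : (A = B * x ^ m ∧ C * x ^ n < B * x ^ m) ∨ (B * x ^ m = C * x ^ n ∧ A < C * x ^ n) ∨
      (A = C * x ^ n ∧ B * x ^ m ≤ C * x ^ n)) : x = x0 := by
  rcases lt_trichotomy x x0 with hlt | heq | hgt
  · exfalso
    have hn1 : x ^ n < x0 ^ n := pow_lt_pow_left₀ hlt hx.le (by omega)
    have hm1 : x ^ m < x0 ^ m := pow_lt_pow_left₀ hlt hx.le (by omega)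
    have hc : C * x ^ n < A := by rw [h1]; exact mul_lt_mul_of_pos_left hn1 hC
    have hb : B * x ^ m < A := by
      rcases hB.eq_or_lt with h0 | h0
      · rw [← h0, zero_mul, h1]; positivity
      · rw [h1]; exact (mul_lt_mul_of_pos_left hm1 h0).trans_le h2
    rcases h with h | h | h <;> linarith [h.1, h.2]
  · exact heq
  · exfalso
    have hn1 : x0 ^ n < x ^ n := pow_lt_pow_left₀ hgt hx0.le (by omega)
    have hc : A < C * x ^ n := by rw [h1]; exact mul_lt_mul_of_pos_left hn1 hC
    have hb : B * x ^ m < C * x ^ n := by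
      obtain ⟨d, rfl⟩ : ∃ d, n = m + d := ⟨n - m, by omega⟩
      rw [pow_add, ← mul_assoc, mul_right_comm] at h2 ⊢
      have h3 : B ≤ C * x0 ^ d := le_of_mul_le_mul_right h2 (by positivity)
      have h4 : x0 ^ d < x ^ d := pow_lt_pow_left₀ hgt hx0.le (by omega)
      have h5 : B < C * x ^ d := h3.trans_lt (mul_lt_mul_of_pos_left h4 hC)
      exact mul_lt_mul_of_pos_right h5 (by positivity)
    rcases h with h | h | h <;> linarith [h.1, h.2]

lemma main_tri (hp : 5 ≤ p) (a b c : ℚ_[p]) (m n : ℕ) (hm : 0 < m) (hmn : m < n)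
    (hbc : b ≠ 0 ∨ c ≠ 0) :
    ((tri a b c m n).roots.filter (fun r => r ≠ 0)).card ≤ 3 * (p - 1) := by
  have hf := tri_ne_zero a b c m n hm hmn hbc
  set R := (tri a b c m n).roots.filter (fun r => r ≠ 0) with hR
  have hRle : R ≤ (tri a b c m n).roots := Multiset.filter_le _ _
  have hR0 : ∀ r ∈ R, r ≠ 0 := fun r hr => (Multiset.mem_filter.mp hr).2
  have hRr : ∀ r ∈ R, (tri a b c m n).eval r = 0 := fun r hr =>
    (Polynomial.mem_roots hf).mp (Multiset.mem_filter.mp hr).1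
  have hcases : ∀ r ∈ R, _ := fun r hr =>
    ultra_three a (b * r ^ m) (c * r ^ n) (by rw [← eval_tri]; exact hRr r hr)
  have hsub : ∀ S : Multiset ℚ_[p], S ≤ R → ∀ r : ℚ_[p],
      (S.filter (fun x => ‖x - r‖ < ‖r‖)).card ≤
        ((tri a b c m n).roots.filter (fun x => ‖x - r‖ < ‖r‖)).card := fun S hS r =>
    Multiset.card_le_card (Multiset.filter_le_filter _ (hS.trans hRle))
  by_cases h3 : ∃ r0 ∈ R, ‖a‖ = ‖c * r0 ^ n‖ ∧ ‖b * r0 ^ m‖ ≤ ‖c * r0 ^ n‖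
  · obtain ⟨r0, hr0, e1, e2⟩ := h3
    have hr0n := norm_pos_iff.mpr (hR0 r0 hr0)
    have hc : c ≠ 0 := by
      rintro rfl
      rw [zero_mul, norm_zero, norm_le_zero_iff] at e2
      have : b = 0 := by simpa [hR0 r0 hr0] using e2
      simp [this] at hbc
    have hall : ∀ r ∈ R, ‖r‖ = ‖r0‖ := by
      intro r hr
      have := hcases r hr
      simp only [norm_mul, norm_pow] at this e1 e2
      exact real_t3 ‖a‖ ‖b‖ ‖c‖ ‖r‖ ‖r0‖ m n hm hmn (norm_nonneg _) (norm_pos_iff.mpr hc)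
        (norm_pos_iff.mpr (hR0 r hr)) hr0n e1 e2 this
    have := sphere_count R 2 ‖r0‖ hr0n hall (fun r hr => (hsub R le_rfl r).trans
      (count_two hp a b c r m n hm hmn hbc (hR0 r hr) (hRr r hr)))
    omega
  · let P : ℚ_[p] → Prop := fun r => ‖a‖ = ‖b * r ^ m‖ ∧ ‖c * r ^ n‖ < ‖b * r ^ m‖
    have hsplit : R.card = (R.filter P).card + (R.filter (fun r => ¬ P r)).card := by
      rw [← Multiset.card_add, Multiset.filter_add_not]
    have hQ : ∀ r ∈ R, ¬ P r → ‖b * r ^ m‖ = ‖c * r ^ n‖ ∧ ‖a‖ < ‖c * r ^ n‖ := by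
      intro r hr hPr
      rcases hcases r hr with h | h | h
      · exact absurd h hPr
      · exact h
      · exact absurd ⟨r, hr, h⟩ h3
    -- left sphere
    have hL : ∀ N, (∀ r ∈ R, P r →
        ((tri a b c m n).roots.filter (fun x => ‖x - r‖ < ‖r‖)).card ≤ N) →
        (R.filter P).card ≤ (p - 1) * N := by
      intro N hN
      rcases Multiset.empty_or_exists_mem (R.filter P) with h | ⟨r0, hr0⟩
      · rw [h]; simp
      obtain ⟨hr0R, hr0P⟩ := Multiset.mem_filter.mp hr0
      refine sphere_count _ N ‖r0‖ (norm_pos_iff.mpr (hR0 r0 hr0R)) ?_ ?_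
      · intro r hr
        obtain ⟨hrR, hrP⟩ := Multiset.mem_filter.mp hr
        have hb : 0 < ‖b‖ := by
          rw [norm_pos_iff]; rintro rfl
          have := hrP.2
          simp only [zero_mul, norm_zero] at this
          exact absurd (norm_nonneg _) (not_le.mpr this)
        have e := hrP.1.symm.trans hr0P.1
        rw [norm_mul, norm_mul, norm_pow, norm_pow] at e
        exact (pow_left_inj₀ (norm_nonneg _) (norm_nonneg _) hm.ne').mp (mul_left_cancel₀ hb.ne' e)
      · intro r hr
        obtain ⟨hrR, hrP⟩ := Multiset.mem_filter.mp hr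
        exact (hsub _ (Multiset.filter_le _ _) r).trans (hN r hrR hrP)
    have hRt : ∀ N, (∀ r ∈ R, ¬ P r →
        ((tri a b c m n).roots.filter (fun x => ‖x - r‖ < ‖r‖)).card ≤ N) →
        (R.filter (fun r => ¬ P r)).card ≤ (p - 1) * N := by
      intro N hN
      rcases Multiset.empty_or_exists_mem (R.filter (fun r => ¬ P r)) with h | ⟨r0, hr0⟩
      · rw [h]; simp
      obtain ⟨hr0R, hr0P⟩ := Multiset.mem_filter.mp hr0
      refine sphere_count _ N ‖r0‖ (norm_pos_iff.mpr (hR0 r0 hr0R)) ?_ ?_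
      · intro r hr
        obtain ⟨hrR, hrP⟩ := Multiset.mem_filter.mp hr
        have hc : 0 < ‖c‖ := by
          rw [norm_pos_iff]; rintro rfl
          have := (hQ r hrR hrP).2
          simp only [zero_mul, norm_zero] at this
          exact absurd (norm_nonneg _) (not_le.mpr this)
        obtain ⟨d, rfl⟩ : ∃ d, n = d + m := ⟨n - m, by omega⟩
        have key : ∀ s ∈ R, ¬ P s → ‖b‖ = ‖c‖ * ‖s‖ ^ d := by
          intro s hs hPs
          have e := (hQ s hs hPs).1
          rw [norm_mul, norm_mul, norm_pow, norm_pow, pow_add, ← mul_assoc] at e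
          exact mul_right_cancel₀ (pow_ne_zero _ (norm_pos_iff.mpr (hR0 s hs)).ne') e
        have e := (key r hrR hrP).symm.trans (key r0 hr0R hr0P)
        exact (pow_left_inj₀ (norm_nonneg _) (norm_nonneg _) (by omega)).mp
          (mul_left_cancel₀ hc.ne' e)
      · intro r hr
        obtain ⟨hrR, hrP⟩ := Multiset.mem_filter.mp hr
        exact (hsub _ (Multiset.filter_le _ _) r).trans (hN r hrR hrP)
    have two : ∀ r ∈ R, ((tri a b c m n).roots.filter (fun x => ‖x - r‖ < ‖r‖)).card ≤ 2 :=
      fun r hr => count_two hp a b c r m n hm hmn hbc (hR0 r hr) (hRr r hr)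
    rcases le_or_gt ‖(n : ℚ_[p])‖ ‖(m : ℚ_[p])‖ with hle | hgt
    · have l1 := hL 1 (fun r hr hPr =>
        count_left hp a b c r m n hm hmn hbc (hR0 r hr) (hRr r hr) hPr.2 hle)
      have l2 := hRt 2 (fun r hr _ => two r hr)
      omega
    · have hnm : ‖(m : ℚ_[p])‖ ≤ ‖(n : ℚ_[p]) - m‖ := by
        have h' : ‖-(m : ℚ_[p])‖ < ‖(n : ℚ_[p])‖ := by rw [norm_neg]; exact hgt
        rw [sub_eq_add_neg, IsUltrametricDist.norm_add_eq_max_of_norm_ne_norm h'.ne',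
          max_eq_left h'.le]
        exact hgt.le
      have l1 := hL 2 (fun r hr _ => two r hr)
      have l2 := hRt 1 (fun r hr hPr =>
        count_right hp a b c r m n hm hmn hbc (hR0 r hr) (hRr r hr) (hQ r hr hPr).2 hnm)
      omega

open Polynomial in
lemma shift_roots (f : Polynomial ℚ_[p]) (hf : f ≠ 0) (k : ℕ) :
    ((X ^ k * f).roots.filter (fun r => r ≠ 0)).card = (f.roots.filter (fun r => r ≠ 0)).card := by
  rw [roots_mul (mul_ne_zero (pow_ne_zero _ X_ne_zero) hf), Multiset.filter_add, Multiset.card_add,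
    roots_X_pow]
  have : (k • ({0} : Multiset ℚ_[p])).filter (fun r => r ≠ 0) = 0 := by
    rw [Multiset.filter_eq_nil]
    intro a ha
    have := Multiset.mem_of_mem_nsmul ha
    simpa using this
  rw [this]; simp

open Polynomial in
lemma part_one (hp : 5 ≤ p) (f : Polynomial ℚ_[p]) (hf : f ≠ 0) (hc : f.support.card ≤ 3) :
    (f.roots.filter (fun r => r ≠ 0)).card ≤ 3 * (p - 1) := by
  have hpos : f.support.card ≠ 0 := by
    rw [Ne, Polynomial.card_support_eq_zero]; exact hf
  have hcase : f.support.card = 1 ∨ f.support.card = 2 ∨ f.support.card = 3 := by omega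
  rcases hcase with h | h | h
  · obtain ⟨k, x, hx, rfl⟩ := card_support_eq_one.mp h
    have := shift_roots (C x) (by simpa using hx) k
    rw [mul_comm, this]
    simp
  · obtain ⟨k, m, hkm, x, y, hx, hy, rfl⟩ := card_support_eq_two.mp h
    have e : C x * X ^ k + C y * X ^ m = X ^ k * tri x y 0 (m - k) (m - k + 1) := by
      obtain ⟨d, rfl⟩ : ∃ d, m = k + d := ⟨m - k, by omega⟩
      simp [tri]; ring
    rw [e, shift_roots _ (tri_ne_zero _ _ _ _ _ (by omega) (by omega) (Or.inl hy))]
    exact main_tri hp _ _ _ _ _ (by omega) (by omega) (Or.inl hy)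
  · obtain ⟨k, m, n, hkm, hmn, x, y, z, hx, hy, hz, rfl⟩ := card_support_eq_three.mp h
    have e : C x * X ^ k + C y * X ^ m + C z * X ^ n = X ^ k * tri x y z (m - k) (n - k) := by
      obtain ⟨d, rfl⟩ : ∃ d, m = k + d := ⟨m - k, by omega⟩
      obtain ⟨d', rfl⟩ : ∃ d', n = k + d' := ⟨n - k, by omega⟩
      simp [tri]; ring
    rw [e, shift_roots _ (tri_ne_zero _ _ _ _ _ (by omega) (by omega) (Or.inl hy))]
    exact main_tri hp _ _ _ _ _ (by omega) (by omega) (Or.inl hy)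

end

section

variable {p : ℕ} [Fact p.Prime]

lemma pow_exp (p : ℕ) (e : ℕ) : ∃ c : ℤ,
    (1 + (p : ℤ) ^ 2) ^ (p ^ e) = 1 + (p : ℤ) ^ (e + 2) * c ∧ (p : ℤ) ∣ c - 1 := by
  induction e with
  | zero => exact ⟨1, by simp, by simp⟩
  | succ e ih =>
    obtain ⟨c, hc, w, hw⟩ := ih
    obtain ⟨k, hk⟩ := Polynomial.powAddExpansion (1 : ℤ) ((p : ℤ) ^ (e + 2) * c) p
    refine ⟨c + k * (p : ℤ) ^ (e + 1) * c ^ 2, ?_, w + k * (p : ℤ) ^ e * c ^ 2, ?_⟩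
    · rw [pow_succ p e, pow_mul, hc, hk]
      simp only [one_pow]
      ring
    · linear_combination hw

open Polynomial in
lemma hensel_unit (F : ℤ_[p][X]) (a : ℤ_[p]) (h1 : ‖F.eval a‖ < 1)
    (h2 : ‖F.derivative.eval a‖ = 1) : ∃ z : ℤ_[p], F.eval z = 0 ∧ ‖z - a‖ < 1 := by
  obtain ⟨z, hz, hza, -⟩ := hensels_lemma (F := F) (a := a) (by
    simpa [Polynomial.coe_aeval_eq_eval, h2] using h1)
  rw [Polynomial.coe_aeval_eq_eval, h2] at hza
  exact ⟨z, by simpa [Polynomial.coe_aeval_eq_eval] using hz, hza⟩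

lemma norm_nat_one {i : ℕ} (h1 : 1 ≤ i) (h2 : i < p) : ‖(i : ℤ_[p])‖ = 1 := by
  rw [PadicInt.norm_def]
  push_cast
  rw [Padic.norm_natCast_eq_one_iff]
  refine (Nat.Prime.coprime_iff_not_dvd Fact.out).mpr fun h => ?_
  have := Nat.le_of_dvd h1 h
  omega

open Polynomial in
lemma roots_set (hp : 5 ≤ p) (z : ℤ_[p]) (hz : ‖z - 1‖ < 1) :
    ∃ S : Finset ℚ_[p], S.card = p - 1 ∧ ∀ x ∈ S, x ^ (p - 1) = (z : ℚ_[p]) := by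
  have key : ∀ i : ℕ, ∃ x : ℤ_[p], 1 ≤ i → i < p → x ^ (p - 1) = z ∧ ‖x - i‖ < 1 := by
    intro i
    by_cases hi : 1 ≤ i ∧ i < p
    · obtain ⟨h1, h2⟩ := hi
      have hn := norm_nat_one h1 h2
      obtain ⟨x, hx, hxi⟩ := hensel_unit (X ^ (p - 1) - C z : ℤ_[p][X]) (i : ℤ_[p]) (by
        simp only [eval_sub, eval_pow, eval_X, eval_C]
        have hd : ‖((i : ℤ_[p]) ^ (p - 1) - 1)‖ < 1 := by
          have : (p : ℤ) ∣ (i : ℤ) ^ (p - 1) - 1 := by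
            have hco : IsCoprime (i : ℤ) (p : ℤ) := by
              rw [Nat.isCoprime_iff_coprime, Nat.coprime_comm]
              refine (Nat.Prime.coprime_iff_not_dvd Fact.out).mpr fun h => ?_
              have := Nat.le_of_dvd h1 h
              omega
            exact (Int.ModEq.pow_card_sub_one_eq_one Fact.out hco).symm.dvd
          have h := (PadicInt.norm_int_lt_one_iff_dvd (p := p) _).mpr this
          push_cast at h
          exact h
        have : (i : ℤ_[p]) ^ (p - 1) - z = ((i : ℤ_[p]) ^ (p - 1) - 1) + (-(z - 1)) := by ring
        rw [this]
        exact PadicInt.norm_lt_one_add hd (by rw [norm_neg]; exact hz)) (by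
        simp only [derivative_sub, derivative_X_pow, derivative_C, sub_zero, eval_mul, eval_pow,
          eval_X, eval_C]
        rw [norm_mul, norm_pow, hn, one_pow, mul_one]
        exact norm_nat_one (by omega) (by omega))
      refine ⟨x, fun _ _ => ⟨?_, hxi⟩⟩
      simpa [sub_eq_zero] using hx
    · exact ⟨0, fun h1 h2 => absurd ⟨h1, h2⟩ hi⟩
  choose g hg using key
  refine ⟨(Finset.Icc 1 (p - 1)).image (fun i => (g i : ℚ_[p])), ?_, ?_⟩
  · rw [Finset.card_image_of_injOn]
    · simp
    · intro i hi j hj hij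
      simp only [Finset.coe_Icc, Set.mem_Icc] at hi hj
      have hij' : g i = g j := Subtype.ext hij
      have hi' := (hg i hi.1 (by omega)).2
      have hj' := (hg j hj.1 (by omega)).2
      rw [hij'] at hi'
      have h : ‖(((i : ℤ) - j : ℤ) : ℤ_[p])‖ < 1 := by
        have : (((i : ℤ) - j : ℤ) : ℤ_[p]) = (g j - j) + -(g j - i) := by push_cast; ring
        rw [this]
        exact PadicInt.norm_lt_one_add hj' (by rw [norm_neg]; exact hi')
      rw [PadicInt.norm_int_lt_one_iff_dvd] at h
      have hab : |(i : ℤ) - j| < p := by rw [abs_lt]; constructor <;> omega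
      have := Int.eq_zero_of_abs_lt_dvd h hab
      omega
  · intro x hx
    obtain ⟨i, hi, rfl⟩ := Finset.mem_image.mp hx
    rw [Finset.mem_Icc] at hi
    have := (hg i hi.1 (by omega)).1
    rw [← this]; push_cast; rfl

lemma norm_int_lt {k : ℤ} (h : (p : ℤ) ∣ k) : ‖(k : ℤ_[p])‖ < 1 :=
  (PadicInt.norm_int_lt_one_iff_dvd k).mpr h

open Polynomial in
lemma third_root (c d A : ℤ) (m N : ℕ) (hN : N ≠ 0) (hc : (p : ℤ) ∣ c - 1) (hd : (p : ℤ) ∣ d - 1)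
    (hm : p ∣ m) :
    ∃ w : ℤ_[p], (d : ℤ_[p]) * w ^ m - c * w ^ (m + 1) + A * (p : ℤ_[p]) ^ N = 0 ∧ ‖w - 1‖ < 1 := by
  obtain ⟨w, hw, hw1⟩ := hensel_unit
    (C (d : ℤ_[p]) * X ^ m - C (c : ℤ_[p]) * X ^ (m + 1) + C (A * (p : ℤ_[p]) ^ N)) 1 (by
      have : (p : ℤ) ∣ d - c + A * p ^ N := by
        have h1 : (p : ℤ) ∣ A * p ^ N := Dvd.dvd.mul_left (dvd_pow_self _ hN) _
        have h2 : (d - c : ℤ) = (d - 1) - (c - 1) := by ring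
        rw [h2]
        exact dvd_add (dvd_sub hd hc) h1
      have h := norm_int_lt this
      push_cast at h
      simpa using h) (by
      have : ¬ (p : ℤ) ∣ d * m - c * (m + 1) := by
        intro h
        have hm' : (p : ℤ) ∣ m := by exact_mod_cast hm
        have h1 : (p : ℤ) ∣ 1 := by
          have : (1 : ℤ) = -(d * m - c * (m + 1)) + (d - c) * m - (c - 1) := by ring
          rw [this]
          exact dvd_sub (dvd_add (dvd_neg.mpr h) (Dvd.dvd.mul_left hm' _)) hc
        have : p ∣ 1 := by exact_mod_cast h1
        exact (Fact.out : p.Prime).one_lt.ne' (Nat.dvd_one.mp this)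
      have h : ¬ ‖((d * m - c * (m + 1) : ℤ) : ℤ_[p])‖ < 1 := by
        rw [PadicInt.norm_int_lt_one_iff_dvd]; exact this
      have h' := le_antisymm (PadicInt.norm_le_one _) (not_lt.mp h)
      push_cast at h'
      simp only [derivative_add, derivative_sub, derivative_C_mul, derivative_X_pow, derivative_C,
        eval_add, eval_sub, eval_mul, eval_C, eval_pow, eval_X, one_pow, mul_one, eval_zero,
        add_zero, Nat.cast_add, Nat.cast_one]
      exact h')
  exact ⟨w, by simpa using hw, hw1⟩

open Polynomial in
lemma part_two (hp : 5 ≤ p) : ∃ f : Polynomial ℚ_[p], f ≠ 0 ∧ f.support.card ≤ 3 ∧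
      3 * (p - 1) ≤ (f.roots.toFinset.filter (fun r => r ≠ 0)).card := by
  have hP : p.Prime := Fact.out
  have hp0 : (p : ℚ_[p]) ≠ 0 := by exact_mod_cast hP.ne_zero
  set e := p - 1 with he
  set m := p ^ e with hm
  have hmpos : 0 < m := pow_pos hP.pos _
  have hpm : p ∣ m := dvd_pow_self _ (by omega)
  obtain ⟨c, hc, hc1⟩ := pow_exp p e
  set d : ℤ := 1 + p ^ e * c * (1 + p ^ 2) with hd
  have hd1 : (p : ℤ) ∣ d - 1 := by
    rw [hd, add_sub_cancel_left, mul_assoc]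
    exact Dvd.dvd.mul_right (dvd_pow_self _ (by omega)) _
  set A : ℤ := p ^ e * c - d with hA
  obtain ⟨w, hw, hw1⟩ := third_root (p := p) c d A m (e * m)
    (Nat.mul_ne_zero (by omega) hmpos.ne') hc1 hd1 hpm
  have hw' : (d : ℚ_[p]) * w ^ m - c * w ^ (m + 1) + A * (p : ℚ_[p]) ^ (e * m) = 0 := by
    have := congrArg (fun z : ℤ_[p] => (z : ℚ_[p])) hw
    push_cast at this
    exact this
  -- norm of `w`
  have hwn : ‖(w : ℚ_[p])‖ = 1 := by
    have h1 : ‖(w : ℚ_[p]) - 1‖ < 1 := by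
      have := hw1; rw [PadicInt.norm_def] at this; push_cast at this; exact this
    have := Padic.norm_eq_of_norm_sub_lt_right (z1 := (w : ℚ_[p])) (z2 := 1) (by simpa using h1)
    simpa using this
  have hd0 : (d : ℚ_[p]) ≠ 0 := by
    intro h
    have h0 : d = 0 := by exact_mod_cast h
    rw [h0] at hd1
    have h1 : (p : ℤ) ∣ 1 := by simpa using hd1
    have : p ∣ 1 := by exact_mod_cast h1
    exact hP.one_lt.ne' (Nat.dvd_one.mp this)
  set f : ℚ_[p][X] := tri (A : ℚ_[p]) (d : ℚ_[p]) (-(p ^ e * c)) (e * m) (e * (m + 1)) with hf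
  have hf0 : f ≠ 0 := tri_ne_zero _ _ _ _ _ (Nat.mul_pos (by omega) hmpos)
    (Nat.mul_lt_mul_of_pos_left (by omega) (by omega)) (Or.inl hd0)
  have hroot : ∀ x : ℚ_[p], (A : ℚ_[p]) + d * (x ^ e) ^ m - p ^ e * c * (x ^ e) ^ (m + 1) = 0 →
      f.eval x = 0 := by
    intro x hx
    rw [hf, eval_tri, pow_mul, pow_mul]
    linear_combination hx
  have hcQ : (1 + (p : ℚ_[p]) ^ 2) ^ m = 1 + (p : ℚ_[p]) ^ (e + 2) * c := by exact_mod_cast hc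
  obtain ⟨S1, hS1c, hS1⟩ := roots_set hp (1 : ℤ_[p]) (by simp)
  obtain ⟨S2, hS2c, hS2⟩ := roots_set hp (1 + (p : ℤ_[p]) ^ 2) (by
    have := norm_int_lt (p := p) (k := (p : ℤ) ^ 2) (dvd_pow_self _ (by norm_num))
    push_cast at this
    simpa using this)
  obtain ⟨S3, hS3c, hS3⟩ := roots_set hp w hw1
  rw [← he] at hS1 hS2 hS3 hS1c hS2c hS3c
  let S4 := S3.image (fun x => x / (p : ℚ_[p]))
  have hS4c : S4.card = e := by
    rw [Finset.card_image_of_injective, hS3c]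
    intro x y hxy
    exact (div_left_inj' hp0).mp hxy
  have hS4 : ∀ x ∈ S4, x ^ e = (w : ℚ_[p]) / p ^ e := by
    intro x hx
    obtain ⟨y, hy, rfl⟩ := Finset.mem_image.mp hx
    rw [div_pow, hS3 y hy]
  have hS2' : ∀ x ∈ S2, x ^ e = 1 + (p : ℚ_[p]) ^ 2 := by
    intro x hx; rw [hS2 x hx]; push_cast; rfl
  have hS1' : ∀ x ∈ S1, x ^ e = 1 := by
    intro x hx; rw [hS1 x hx]; push_cast; rfl
  have hbig : 1 < ‖(w : ℚ_[p]) / p ^ e‖ := by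
    rw [norm_div, hwn, norm_pow]
    have h0 : 0 < ‖(p : ℚ_[p])‖ := norm_pos_iff.mpr hp0
    rw [one_lt_div (by positivity)]
    exact pow_lt_one₀ h0.le Padic.norm_p_lt_one (by omega)
  have hsmall : ‖1 + (p : ℚ_[p]) ^ 2‖ ≤ 1 := by
    have := Padic.norm_int_le_one (p := p) (1 + (p : ℤ) ^ 2)
    push_cast at this; exact this
  have d12 : Disjoint S1 S2 := by
    rw [Finset.disjoint_left]
    intro x h1 h2
    have := (hS1' x h1).symm.trans (hS2' x h2)
    have : (p : ℚ_[p]) ^ 2 = 0 := by linear_combination -this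
    exact hp0 (by simpa using this)
  have d3 : Disjoint (S1 ∪ S2) S4 := by
    rw [Finset.disjoint_left]
    intro x h1 h2
    rw [← hS4 x h2] at hbig
    rcases Finset.mem_union.mp h1 with h | h
    · rw [hS1' x h, norm_one] at hbig; exact lt_irrefl _ hbig
    · rw [hS2' x h] at hbig; exact absurd hsmall (not_le.mpr hbig)
  have hcard : ((S1 ∪ S2) ∪ S4).card = 3 * e := by
    rw [Finset.card_union_of_disjoint d3, Finset.card_union_of_disjoint d12, hS1c, hS2c, hS4c]
    ring
  have hAQ : (A : ℚ_[p]) = p ^ e * c - d := by rw [hA]; push_cast; rfl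
  have hdQ : (d : ℚ_[p]) = 1 + p ^ e * c * (1 + p ^ 2) := by rw [hd]; push_cast; rfl
  refine ⟨f, hf0, ?_, ?_⟩
  · rw [hf, tri, ← mul_one (C (A : ℚ_[p])), ← pow_zero X]
    refine (Finset.card_le_card support_add).trans ((Finset.card_union_le _ _).trans ?_)
    have h1 := (Finset.card_le_card (support_add (p := C (A : ℚ_[p]) * X ^ 0)
      (q := C (d : ℚ_[p]) * X ^ (e * m)))).trans (Finset.card_union_le _ _)
    have h2 := card_support_C_mul_X_pow_le_one (c := (A : ℚ_[p])) (n := 0)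
    have h3 := card_support_C_mul_X_pow_le_one (c := (d : ℚ_[p])) (n := e * m)
    have h4 := card_support_C_mul_X_pow_le_one (c := (-(p ^ e * c) : ℚ_[p])) (n := e * (m + 1))
    omega
  · rw [← hcard]
    refine Finset.card_le_card fun x hx => ?_
    have hxe : x ^ e ≠ 0 ∧ f.eval x = 0 := by
      rcases Finset.mem_union.mp hx with hx | hx
      · rcases Finset.mem_union.mp hx with hx | hx
        · refine ⟨by rw [hS1' x hx]; exact one_ne_zero, hroot x ?_⟩
          rw [hS1' x hx, hAQ]; simp
        · refine ⟨?_, hroot x ?_⟩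
          · rw [hS2' x hx]
            have h : ((1 + p ^ 2 : ℕ) : ℚ_[p]) ≠ 0 := by
              rw [Nat.cast_ne_zero]; omega
            push_cast at h
            exact h
          · rw [hS2' x hx, pow_succ _ m, hcQ, hAQ, hdQ]
            ring
      · refine ⟨?_, hroot x ?_⟩
        · rw [hS4 x hx]; intro h; rw [h, norm_zero] at hbig; linarith
        · rw [hS4 x hx, div_pow, div_pow, ← pow_mul, ← pow_mul]
          have hq : (p : ℚ_[p]) ^ (e * (m + 1)) = p ^ (e * m) * p ^ e := by rw [← pow_add]; rfl
          have hq1 : (p : ℚ_[p]) ^ (e * m) ≠ 0 := pow_ne_zero _ hp0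
          have hq2 : (p : ℚ_[p]) ^ e ≠ 0 := pow_ne_zero _ hp0
          rw [hq]
          generalize (p : ℚ_[p]) ^ (e * m) = Q at *
          generalize (p : ℚ_[p]) ^ e = q at *
          field_simp
          linear_combination hw'
    rw [Finset.mem_filter, Multiset.mem_toFinset, mem_roots hf0]
    refine ⟨hxe.2, ?_⟩
    rintro rfl
    exact hxe.1 (zero_pow (by omega))

end



/-- For a prime `p ≥ 5`: (i) every nonzero polynomial over
`ℚ_p` with at most `3` nonzero terms has at most `3(p−1)` nonzero roots counted
with multiplicities; (ii) some nonzero polynomial over `ℚ_p` with at most `3`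
nonzero terms has at least `3(p−1)` distinct nonzero roots.  Consequently
`B₁(2,ℚ_p) = B_m(2,ℚ_p) = 3(p−1)`. -/
theorem trinomial_roots_Qp (p : ℕ) [Fact p.Prime] (hp : 5 ≤ p) :
    (∀ f : Polynomial ℚ_[p], f ≠ 0 → f.support.card ≤ 3 →
      (f.roots.filter (fun r => r ≠ 0)).card ≤ 3 * (p - 1)) ∧
    (∃ f : Polynomial ℚ_[p], f ≠ 0 ∧ f.support.card ≤ 3 ∧
      3 * (p - 1) ≤ (f.roots.toFinset.filter (fun r => r ≠ 0)).card) := by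
  exact ⟨fun f hf hc => part_one hp f hf hc, part_two hp⟩
end
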